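/- arXiv:1204.3042 — 10 statements merged into one kernel-verified Lean document; each statement's English description precedes it below -/
import Mathlib

section
/- Let K be a field of characteristic zero and V a K-vector space of dimension 3. Let x ∈ V* be a nonzero linear form and q a nonzero quadratic form on V. Suppose x²q = l₁⁴ + l₂⁴ + l₃⁴ + l₄⁴ + l₅⁴ + l₆⁴ + l₇⁴ for linear forms l₁,…,l₇ ∈ V* such that the seven lines lᵢ = 0 in P(V) intersect the line x = 0 in seven distinct points (equivalently, no lᵢ is a scalar multiple of x, and for i ≠ j the planes ker lᵢ ∩ ker x and ker lⱼ ∩ ker x are distinct one-dimensional subspaces). Then the line x = 0 is (possibly improperly) tangent to the conic q = 0; that is, there exists a nonzero vector w ∈ ker x such that the polar bilinear form of q, namely B(w,u) = q(w+u) − q(w) − q(u), vanishes for every u ∈ ker x. -/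
open MvPolynomial

/-- A homogeneous polynomial of degree one evaluates as a linear form. -/
lemma MvPolynomial.IsHomogeneous.exists_linearMap_eval {σ K : Type*} [Fintype σ] [CommRing K]
    {p : MvPolynomial σ K} (hp : p.IsHomogeneous 1) :
    ∃ L : (σ → K) →ₗ[K] K, ∀ v, eval v p = L v := by
  have hp' : p ∈ homogeneousSubmodule σ K 1 := hp
  rw [homogeneousSubmodule_one_eq_span_X, Submodule.mem_span_range_iff_exists_fun] at hp'
  obtain ⟨c, rfl⟩ := hp'
  refine ⟨∑ j, c j • LinearMap.proj j, fun v => ?_⟩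
  simp [map_sum, smul_eval]

/-- The values of a polynomial of degree less than `#s - 1`, weighted by the nodal weights,
sum to zero. -/
lemma Lagrange.sum_nodalWeight_mul_eval_eq_coeff {F ι : Type*} [Field F] [DecidableEq ι]
    {s : Finset ι} {v : ι → F} (hv : Set.InjOn v s) {P : Polynomial F} (hP : P.degree < s.card) :
    ∑ i ∈ s, Lagrange.nodalWeight s v i * P.eval (v i) = P.coeff (s.card - 1) := by
  rw [Lagrange.coeff_eq_sum hv hP]
  refine Finset.sum_congr rfl fun i _ => ?_
  rw [Lagrange.nodalWeight, Finset.prod_inv_distrib, div_eq_mul_inv, mul_comm]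

/-- If the first `m` moments of `e` at `n` distinct nodes vanish, then `e` is the product of the
nodal weights with the values of a polynomial of degree less than `n - m`. -/
lemma Lagrange.exists_eq_nodalWeight_mul_eval {F : Type*} [Field F] {n m : ℕ}
    {t : Fin n → F} (ht : Function.Injective t) (e : Fin n → F)
    (he : ∀ k < m, ∑ i, e i * t i ^ k = 0) :
    ∃ P : Polynomial F, P.degree < (n - m : ℕ) ∧
      ∀ i, e i = Lagrange.nodalWeight Finset.univ t i * P.eval (t i) := by
  have hinj : Set.InjOn t (Finset.univ : Finset (Fin n)) := ht.injOn
  set W := Lagrange.nodalWeight Finset.univ t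
  have hW : ∀ i, W i ≠ 0 := fun i => Lagrange.nodalWeight_ne_zero hinj (Finset.mem_univ i)
  set P := Lagrange.interpolate Finset.univ t fun i => e i / W i
  have hPe : ∀ i, e i = W i * P.eval (t i) := fun i => by
    rw [Lagrange.eval_interpolate_at_node _ hinj (Finset.mem_univ i), mul_div_cancel₀ _ (hW i)]
  have hPn : P.degree < n := by
    rw [← Finset.card_fin n]
    exact Lagrange.degree_interpolate_lt _ hinj
  refine ⟨P, ?_, hPe⟩
  by_contra! hdeg
  have hP0 : P ≠ 0 := by
    rintro h
    simp [h] at hdeg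
  rw [Polynomial.degree_eq_natDegree hP0] at hdeg hPn
  norm_cast at hdeg hPn
  have hcard : (Finset.univ : Finset (Fin n)).card = n := by simp
  have hXP : (P * Polynomial.X ^ (n - 1 - P.natDegree)).degree <
      ((Finset.univ : Finset (Fin n)).card : WithBot ℕ) := by
    rw [hcard, Polynomial.degree_mul, Polynomial.degree_X_pow, Polynomial.degree_eq_natDegree hP0]
    norm_cast
    omega
  have hsum := Lagrange.sum_nodalWeight_mul_eval_eq_coeff hinj hXP
  rw [hcard] at hsum
  have hidx : n - 1 = P.natDegree + (n - 1 - P.natDegree) := by omega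
  have hcoeff : (P * Polynomial.X ^ (n - 1 - P.natDegree)).coeff (n - 1) = P.leadingCoeff := by
    conv_lhs => rw [hidx, Nat.add_sub_cancel_left]
    rw [Polynomial.coeff_mul_X_pow, Polynomial.leadingCoeff]
  rw [hcoeff] at hsum
  refine hP0 (Polynomial.leadingCoeff_eq_zero.mp ?_)
  rw [← hsum, ← he (n - 1 - P.natDegree) (by omega)]
  refine Finset.sum_congr rfl fun i _ => ?_
  rw [hPe i, Polynomial.eval_mul, Polynomial.eval_pow, Polynomial.eval_X, mul_assoc]

/-- Extraction of the moments from a family of vanishing sums of powers. -/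
lemma sum_mul_pow_eq_zero_of_forall {K ι : Type*} [Field K] [CharZero K] [Fintype ι] {n : ℕ}
    {e t : ι → K} (h : ∀ b : K, ∑ i, e i * (1 + t i * b) ^ n = 0) {k : ℕ} (hk : k ≤ n) :
    ∑ i, e i * t i ^ k = 0 := by
  have hp : ∑ i, Polynomial.C (e i) *
      ((1 + Polynomial.X) ^ n : Polynomial K).comp (Polynomial.C (t i) * Polynomial.X) = 0 := by
    refine Polynomial.funext fun b => ?_
    simpa [Polynomial.eval_finsetSum] using h b
  have hc := congrArg (fun p : Polynomial K => p.coeff k) hp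
  simp only [Polynomial.finsetSum_coeff, Polynomial.coeff_C_mul, Polynomial.comp_C_mul_X_coeff,
    Polynomial.coeff_one_add_X_pow, Polynomial.coeff_zero] at hc
  have hne : (n.choose k : K) ≠ 0 := Nat.cast_ne_zero.mpr (Nat.choose_pos hk).ne'
  refine (mul_eq_zero.mp ?_).resolve_left hne
  rw [← hc, Finset.mul_sum]
  exact Finset.sum_congr rfl fun i _ => by ring

/-- The lowest three coefficients of a sum of fourth powers divisible by the square of the
variable. -/
lemma coeff_of_sq_mul_eq_sum_pow_four {K ι : Type*} [Field K] [CharZero K] [Fintype ι]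
    {a m : ι → K} {f : Polynomial K} (h : ∀ c : K, c ^ 2 * f.eval c = ∑ i, (a i * c + m i) ^ 4) :
    ∑ i, m i ^ 4 = 0 ∧ ∑ i, a i * m i ^ 3 = 0 ∧
      6 * ∑ i, a i ^ 2 * m i ^ 2 = f.eval 0 := by
  have hp : f * Polynomial.X ^ 2 = ∑ i, (Polynomial.C (m i ^ 4)
      + Polynomial.C (4 * (a i * m i ^ 3)) * Polynomial.X ^ 1
      + Polynomial.C (6 * (a i ^ 2 * m i ^ 2)) * Polynomial.X ^ 2
      + Polynomial.C (4 * a i ^ 3 * m i) * Polynomial.X ^ 3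
      + Polynomial.C (a i ^ 4) * Polynomial.X ^ 4) := by
    refine Polynomial.funext fun c => ?_
    simp only [Polynomial.eval_finsetSum, Polynomial.eval_mul, Polynomial.eval_add,
      Polynomial.eval_pow, Polynomial.eval_X, Polynomial.eval_C]
    rw [mul_comm, h c]
    exact Finset.sum_congr rfl fun i _ => by ring
  have hc (k : ℕ) := congrArg (fun p : Polynomial K => p.coeff k) hp
  simp only [Polynomial.coeff_mul_X_pow', Polynomial.finsetSum_coeff, Polynomial.coeff_add,
    Polynomial.coeff_C] at hc
  have h0 := hc 0
  have h1 := hc 1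
  have h2 := hc 2
  simp at h0 h1 h2
  rw [← Finset.mul_sum] at h1 h2
  refine ⟨h0.symm, by simpa using h1, ?_⟩
  rw [← h2, Polynomial.coeff_zero_eq_eval_zero]

/-- The binary core of the tangency statement: if the seven binary linear forms
`mᵢ = sᵢ (α + tᵢ β)` satisfy `∑ mᵢ⁴ = 0` and `∑ aᵢ mᵢ³ = 0`, then the binary quadratic form
`∑ aᵢ² mᵢ²` is degenerate. -/
lemma exists_kernel_of_moments {K : Type*} [Field K] {t s a : Fin 7 → K}
    (ht : Function.Injective t) (hs : ∀ i, s i ≠ 0)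
    (h4 : ∀ k < 5, ∑ i, s i ^ 4 * t i ^ k = 0)
    (h3 : ∀ k < 4, ∑ i, a i * s i ^ 3 * t i ^ k = 0) :
    ∃ α β : K, (∃ i, s i * (α + t i * β) ≠ 0) ∧
      ∀ γ δ : K, ∑ i, a i ^ 2 * (s i * (α + t i * β)) * (s i * (γ + t i * δ)) = 0 := by
  obtain ⟨f, hf, hfe⟩ := Lagrange.exists_eq_nodalWeight_mul_eval ht _ h4
  obtain ⟨g, hg, hge⟩ := Lagrange.exists_eq_nodalWeight_mul_eval ht _ h3
  have hfX : f = Polynomial.C (f.coeff 1) * Polynomial.X + Polynomial.C (f.coeff 0) :=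
    Polynomial.eq_X_add_C_of_degree_le_one (Order.le_of_lt_succ hf)
  have hfev : ∀ i, f.eval (t i) = f.coeff 0 + t i * f.coeff 1 := fun i => by
    conv_lhs => rw [hfX]
    simp only [Polynomial.eval_add, Polynomial.eval_mul, Polynomial.eval_C, Polynomial.eval_X]
    ring
  refine ⟨f.coeff 0, f.coeff 1, ⟨0, ?_⟩, fun γ δ => ?_⟩
  · rw [← hfev]
    refine mul_ne_zero (hs 0) fun h => hs 0 ?_
    have := hfe 0
    rw [h, mul_zero] at this
    exact pow_eq_zero_iff (by norm_num) |>.mp this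
  · set P : Polynomial K := g ^ 2 * (Polynomial.C δ * Polynomial.X + Polynomial.C γ)
    have hP5 : P.natDegree ≤ 5 := by
      have hg2 : g.natDegree ≤ 2 := Polynomial.natDegree_le_iff_degree_le.mpr
        (Order.le_of_lt_succ hg)
      calc P.natDegree ≤ 2 * g.natDegree + 1 :=
            Polynomial.natDegree_mul_le_of_le Polynomial.natDegree_pow_le
              Polynomial.natDegree_linear_le
        _ ≤ 5 := by omega
    have hsum := Lagrange.sum_nodalWeight_mul_eval_eq_coeff (s := Finset.univ) (P := P) ht.injOn
      (Polynomial.degree_le_of_natDegree_le hP5 |>.trans_lt (by simp; norm_num))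
    rw [Polynomial.coeff_eq_zero_of_natDegree_lt (hP5.trans_lt (by simp))] at hsum
    rw [← hsum]
    refine Finset.sum_congr rfl fun i _ => ?_
    rw [← hfev]
    simp only [P, Polynomial.eval_add, Polynomial.eval_mul, Polynomial.eval_C, Polynomial.eval_X,
      Polynomial.eval_pow]
    have hW := Lagrange.nodalWeight_ne_zero (s := Finset.univ) ht.injOn (Finset.mem_univ i)
    have hf4 := hfe i
    have hg3 := hge i
    generalize Lagrange.nodalWeight Finset.univ t i = W at *
    have key : a i ^ 2 * s i ^ 2 * f.eval (t i) = W * g.eval (t i) ^ 2 := by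
      refine mul_left_cancel₀ hW ?_
      linear_combination (-a i ^ 2 * s i ^ 2) * hf4
        + (a i * s i ^ 3 + W * g.eval (t i)) * hg3
    linear_combination (γ + t i * δ) * key

/-- A plane contains a basis whose first vector avoids the kernels of finitely many nonzero linear
forms. -/
lemma exists_spanning_pair_forall_ne_zero {K E ι : Type*} [Field K] [Infinite K] [AddCommGroup E]
    [Module K E] [Fintype ι] (hE : Module.finrank K E = 2) (L : ι → E →ₗ[K] K)
    (hL : ∀ i, L i ≠ 0) :
    ∃ v₁ v₂ : E, (∀ u, ∃ α β : K, u = α • v₁ + β • v₂) ∧ ∀ i, L i v₁ ≠ 0 := by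
  classical
  have : FiniteDimensional K E := Module.finite_of_finrank_eq_succ hE
  let b := Module.finBasisOfFinrankEq K E hE
  obtain ⟨c, hc⟩ := Infinite.exists_notMem_finset
    (Finset.univ.image fun i => -L i (b 0) / L i (b 1))
  have hu : ∀ u, u = b.repr u 0 • (b 0 + c • b 1) + (b.repr u 1 - b.repr u 0 * c) • b 1 := by
    intro u
    conv_lhs => rw [← b.sum_repr u, Fin.sum_univ_two]
    module
  refine ⟨b 0 + c • b 1, b 1, fun u => ⟨_, _, hu u⟩, fun i h => ?_⟩
  by_cases h1 : L i (b 1) = 0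
  · refine hL i (LinearMap.ext fun u => ?_)
    rw [hu u, map_add, map_smul, map_smul, h, h1]
    simp
  · refine hc (Finset.mem_image.mpr ⟨i, Finset.mem_univ i, ?_⟩)
    rw [div_eq_iff h1]
    simp only [map_add, map_smul, smul_eq_mul] at h
    linear_combination -h

/-- if `x² q = l₁⁴ + ⋯ + l₇⁴` where the seven lines `lᵢ = 0` meet the
line `x = 0` in seven distinct points, then the line `x = 0` is (possibly improperly)
tangent to the conic `q = 0`: some nonzero `w` with `x(w) = 0` lies in the kernel of
the polar form of `q` restricted to `ker x`. (Char 0, `V ≅ K³` after a choice of basis.) -/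
theorem stmt_0 (K : Type*) [Field K] [CharZero K]
    (x q : MvPolynomial (Fin 3) K) (l : Fin 7 → MvPolynomial (Fin 3) K)
    (hx : x.IsHomogeneous 1) (hx0 : x ≠ 0)
    (hq : q.IsHomogeneous 2) (hq0 : q ≠ 0)
    (hl : ∀ i, (l i).IsHomogeneous 1)
    (heq : x ^ 2 * q = ∑ i, l i ^ 4)
    (hnp : ∀ (i : Fin 7) (c : K), l i ≠ C c * x)
    (hdist : ∀ i j : Fin 7, i ≠ j →
      {v : Fin 3 → K | eval v (l i) = 0 ∧ eval v x = 0} ≠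
      {v : Fin 3 → K | eval v (l j) = 0 ∧ eval v x = 0}) :
    ∃ w : Fin 3 → K, w ≠ 0 ∧ eval w x = 0 ∧
      ∀ u : Fin 3 → K, eval u x = 0 →
        eval (w + u) q - eval w q - eval u q = 0 := by
  obtain ⟨Lx, hLx⟩ := hx.exists_linearMap_eval
  choose L hL using fun i => (hl i).exists_linearMap_eval
  obtain ⟨v₀, hv₀⟩ : ∃ v₀, Lx v₀ = 1 := by
    have hLx0 : Lx ≠ 0 := by
      rintro rfl
      exact hx0 (MvPolynomial.funext fun v => by simp [hLx])
    exact LinearMap.surjective hLx0 1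
  have hker : Module.finrank K (LinearMap.ker Lx) = 2 := by
    have hrk := Lx.finrank_range_add_finrank_ker
    rw [LinearMap.range_eq_top.mpr fun c => ⟨c • v₀, by simp [hv₀]⟩] at hrk
    simp at hrk
    omega
  have hLker : ∀ i, L i ∘ₗ (LinearMap.ker Lx).subtype ≠ 0 := by
    intro i h
    refine hnp i (L i v₀) (MvPolynomial.funext fun v => ?_)
    have hv := LinearMap.congr_fun h ⟨v - Lx v • v₀, by simp [hv₀]⟩
    simp only [LinearMap.comp_apply, Submodule.subtype_apply, map_sub, map_smul, smul_eq_mul,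
      LinearMap.zero_apply] at hv
    simp only [hL, hLx, eval_mul, eval_C]
    linear_combination hv
  obtain ⟨⟨v₁, hv₁⟩, ⟨v₂, hv₂⟩, hspan, hs⟩ := exists_spanning_pair_forall_ne_zero hker _ hLker
  replace hs : ∀ i, L i v₁ ≠ 0 := hs
  replace hspan : ∀ u, Lx u = 0 → ∃ α β : K, u = α • v₁ + β • v₂ := fun u hu => by
    obtain ⟨α, β, h⟩ := hspan ⟨u, hu⟩
    exact ⟨α, β, congrArg Subtype.val h⟩
  rw [LinearMap.mem_ker] at hv₁ hv₂
  obtain ⟨t, htL⟩ : ∃ t : Fin 7 → K, ∀ i, L i v₂ = L i v₁ * t i :=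
    ⟨fun i => L i v₂ / L i v₁, fun i => (mul_div_cancel₀ _ (hs i)).symm⟩
  have hLu : ∀ (i) (α β : K), L i (α • v₁ + β • v₂) = L i v₁ * (α + t i * β) := fun i α β => by
    rw [map_add, map_smul, map_smul, htL, smul_eq_mul, smul_eq_mul]
    ring
  have ht : Function.Injective t := by
    intro i j hij
    by_contra hne
    refine hdist i j hne (Set.ext fun v => ?_)
    simp only [Set.mem_ofPred_eq, hL, hLx]
    refine and_congr_left fun hv => ?_
    obtain ⟨α, β, rfl⟩ := hspan v hv
    simp [hLu, hs, hij]
  have hcoeff : ∀ u, Lx u = 0 → ∑ i, L i u ^ 4 = 0 ∧ ∑ i, L i v₀ * L i u ^ 3 = 0 ∧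
      6 * ∑ i, L i v₀ ^ 2 * L i u ^ 2 = eval u q := by
    intro u hu
    let f : Polynomial K :=
      aeval (fun j => Polynomial.C (v₀ j) * Polynomial.X + Polynomial.C (u j)) q
    have hf : ∀ c, f.eval c = eval (c • v₀ + u) q := fun c => by
      simp only [f]
      rw [← Polynomial.coe_evalRingHom, aeval_def, hom_eval₂, eval, coe_eval₂Hom]
      congr 1
      · ext; simp
      · ext j
        simp only [Polynomial.coe_evalRingHom, Polynomial.eval_add,
          Polynomial.eval_mul, Polynomial.eval_C, Polynomial.eval_X, Pi.add_apply, Pi.smul_apply,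
          smul_eq_mul, mul_comm c]
    have h := coeff_of_sq_mul_eq_sum_pow_four (f := f) (a := fun i => L i v₀)
      (m := fun i => L i u) fun c => by
        have hc := congrArg (eval (c • v₀ + u)) heq
        simp only [map_mul, map_pow, map_sum, hLx, hL, map_add, map_smul, hv₀, hu, smul_eq_mul,
          mul_one, add_zero] at hc
        rw [hf, hc]
        exact Finset.sum_congr rfl fun i _ => by ring
    rwa [hf, zero_smul, zero_add] at h
  have hmem : ∀ α β : K, Lx (α • v₁ + β • v₂) = 0 := fun α β => by simp [hv₁, hv₂]
  obtain ⟨α, β, ⟨i, hi⟩, hw⟩ := exists_kernel_of_moments (a := fun i => L i v₀) ht hs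
    (fun k hk => sum_mul_pow_eq_zero_of_forall (n := 4) (fun b => by
      rw [← (hcoeff _ (hmem 1 b)).1]
      exact Finset.sum_congr rfl fun i _ => by rw [hLu]; ring) (by omega))
    (fun k hk => sum_mul_pow_eq_zero_of_forall (n := 3) (fun b => by
      rw [← (hcoeff _ (hmem 1 b)).2.1]
      exact Finset.sum_congr rfl fun i _ => by rw [hLu]; ring) (by omega))
  refine ⟨α • v₁ + β • v₂, fun h => hi ?_, by rw [hLx, hmem], fun u hu => ?_⟩
  · rw [← hLu, h, map_zero]
  · rw [hLx] at hu
    obtain ⟨γ, δ, rfl⟩ := hspan u hu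
    have hadd : Lx (α • v₁ + β • v₂ + (γ • v₁ + δ • v₂)) = 0 := by
      rw [map_add, hmem, hmem, add_zero]
    rw [← (hcoeff _ hadd).2.2, ← (hcoeff _ (hmem α β)).2.2, ← (hcoeff _ (hmem γ δ)).2.2,
      ← mul_sub, ← mul_sub, ← Finset.sum_sub_distrib, ← Finset.sum_sub_distrib]
    refine mul_eq_zero_of_right _ ?_
    rw [← mul_zero 2, ← hw γ δ, Finset.mul_sum]
    refine Finset.sum_congr rfl fun i _ => ?_
    rw [map_add, hLu, hLu]
    ring
end

section
/- Let K be a field of characteristic zero. Let h₁,…,h₇ ∈ K be pairwise distinct, and let α₁,…,α₇, k₁,…,k₇ ∈ K satisfy Σᵢ₌₁⁷ αᵢ hᵢᵈ = 0 for all d with 0 ≤ d ≤ 4, and Σᵢ₌₁⁷ αᵢ kᵢ hᵢᵈ = 0 for all d with 0 ≤ d ≤ 3. Then (Σᵢ₌₁⁷ αᵢ kᵢ² hᵢ)² − (Σᵢ₌₁⁷ αᵢ kᵢ²)(Σᵢ₌₁⁷ αᵢ kᵢ² hᵢ²) = 0. -/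
open Polynomial Lagrange in
/-- The sum of the values of a polynomial of degree less than the number of nodes, weighted by
the nodal weights, is its top coefficient. -/
theorem sum_eval_mul_nodalWeight {K ι : Type*} [Field K] [DecidableEq ι] {s : Finset ι}
    {v : ι → K} (hv : Set.InjOn v s) {P : K[X]} (hP : P.degree < s.card) :
    ∑ i ∈ s, P.eval (v i) * nodalWeight s v i = P.coeff (s.card - 1) := by
  rw [coeff_eq_sum hv hP]
  simp only [nodalWeight, Finset.prod_inv_distrib, div_eq_mul_inv]

open Polynomial Lagrange in
/-- A vector orthogonal to the first `m` powers of the nodes consists of the nodal weights times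
the values of a polynomial of degree less than `s.card - m`. -/
theorem exists_eval_mul_nodalWeight_eq {K ι : Type*} [Field K] [DecidableEq ι] {s : Finset ι}
    {v : ι → K} (hv : Set.InjOn v s) {m : ℕ} {c : ι → K}
    (hc : ∀ d < m, ∑ i ∈ s, c i * v i ^ d = 0) :
    ∃ P : K[X], P.degree < (s.card - m : ℕ) ∧ ∀ i ∈ s, c i = P.eval (v i) * nodalWeight s v i := by
  set P := interpolate s v fun i => c i / nodalWeight s v i with hPdef
  have hPc : ∀ i ∈ s, c i = P.eval (v i) * nodalWeight s v i := fun i hi => by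
    rw [hPdef, eval_interpolate_at_node _ hv hi, div_mul_cancel₀ _ (nodalWeight_ne_zero hv hi)]
  refine ⟨P, ?_, hPc⟩
  by_cases hP0 : P = 0
  · rw [hP0, degree_zero]
    exact WithBot.bot_lt_coe _
  have hlt : P.natDegree < s.card :=
    (natDegree_lt_iff_degree_lt hP0).2 (degree_interpolate_lt _ hv)
  rw [← natDegree_lt_iff_degree_lt hP0]
  by_contra! hle
  have hdeg : (P * X ^ (s.card - 1 - P.natDegree)).degree < (s.card : WithBot ℕ) := by
    rw [degree_mul, degree_X_pow, degree_eq_natDegree hP0]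
    norm_cast
    lia
  have hsum := sum_eval_mul_nodalWeight hv hdeg
  have hcoeff : (P * X ^ (s.card - 1 - P.natDegree)).coeff (s.card - 1) = P.leadingCoeff := by
    rw [coeff_mul_X_pow', if_pos (by lia), leadingCoeff]
    congr 1
    lia
  rw [hcoeff] at hsum
  refine leadingCoeff_ne_zero.2 hP0 (hsum.symm.trans ?_)
  rw [← hc (s.card - 1 - P.natDegree) (by lia)]
  refine Finset.sum_congr rfl fun i hi => ?_
  rw [hPc i hi, eval_mul, eval_pow, eval_X]
  ring


/-- with `h₁,…,h₇` pairwise distinct, `∑ αᵢ hᵢᵈ = 0` for `0 ≤ d ≤ 4` and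
`∑ αᵢ kᵢ hᵢᵈ = 0` for `0 ≤ d ≤ 3` imply
`(∑ αᵢ kᵢ² hᵢ)² − (∑ αᵢ kᵢ²)(∑ αᵢ kᵢ² hᵢ²) = 0`. -/
theorem stmt_1 (K : Type*) [Field K] [CharZero K]
    (h k α : Fin 7 → K)
    (hdist : Function.Injective h)
    (h1 : ∀ d : ℕ, d ≤ 4 → ∑ i, α i * h i ^ d = 0)
    (h2 : ∀ d : ℕ, d ≤ 3 → ∑ i, α i * k i * h i ^ d = 0) :
    (∑ i, α i * k i ^ 2 * h i) ^ 2 -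
      (∑ i, α i * k i ^ 2) * (∑ i, α i * k i ^ 2 * h i ^ 2) = 0 := by
  have hv : Set.InjOn h (Finset.univ : Finset (Fin 7)) := hdist.injOn
  set w := Lagrange.nodalWeight Finset.univ h with hw
  have hw0 : ∀ i, w i ≠ 0 := fun i => Lagrange.nodalWeight_ne_zero hv (Finset.mem_univ i)
  obtain ⟨P, hPdeg, hP⟩ := exists_eval_mul_nodalWeight_eq hv (m := 5) (c := α)
    fun d hd => h1 d (by lia)
  obtain ⟨Q, hQdeg, hQ⟩ := exists_eval_mul_nodalWeight_eq hv (m := 4) (c := fun i => α i * k i)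
    fun d hd => h2 d (by lia)
  simp only [Finset.card_univ, Fintype.card_fin, Finset.mem_univ, true_imp_iff, ← hw,
    Nat.reduceSub] at hP hQ hPdeg hQdeg
  have hP1 : P.natDegree ≤ 1 := Polynomial.natDegree_le_of_degree_le (Order.le_of_lt_succ hPdeg)
  have hQ2 : Q.natDegree ≤ 2 := Polynomial.natDegree_le_of_degree_le (Order.le_of_lt_succ hQdeg)
  obtain ⟨b, a, hPab⟩ := Polynomial.exists_eq_X_add_C_of_natDegree_le_one hP1
  have hα : ∀ i, α i = (b * h i + a) * w i := fun i => by simpa [hPab] using hP i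
  have hterm : ∀ i, α i * k i ^ 2 * (b * h i + a) = Q.eval (h i) ^ 2 * w i := fun i => by
    apply mul_right_cancel₀ (hw0 i)
    linear_combination -(α i * k i ^ 2) * hα i + (α i * k i + Q.eval (h i) * w i) * hQ i
  have hrec : ∀ d ≤ 1, ∑ i, α i * k i ^ 2 * (b * h i + a) * h i ^ d = 0 := fun d hd => by
    have hdeg : (Q ^ 2 * Polynomial.X ^ d).natDegree < 6 := by
      have := Polynomial.natDegree_mul_le (p := Q ^ 2) (q := Polynomial.X ^ d)
      have := Polynomial.natDegree_pow_le (p := Q) (n := 2)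
      rw [Polynomial.natDegree_X_pow] at *
      lia
    have hsum := sum_eval_mul_nodalWeight hv (P := Q ^ 2 * Polynomial.X ^ d)
      (Polynomial.degree_le_natDegree.trans_lt (by
        rw [Finset.card_univ, Fintype.card_fin]
        exact_mod_cast hdeg.trans (by lia)))
    rw [Finset.card_univ, Fintype.card_fin, Polynomial.coeff_eq_zero_of_natDegree_lt hdeg] at hsum
    rw [← hsum]
    refine Finset.sum_congr rfl fun i _ => ?_
    rw [hterm, Polynomial.eval_mul, Polynomial.eval_pow, Polynomial.eval_pow, Polynomial.eval_X]
    ring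
  have e0 : b * ∑ i, α i * k i ^ 2 * h i + a * ∑ i, α i * k i ^ 2 = 0 := by
    rw [← hrec 0 (by lia), Finset.mul_sum, Finset.mul_sum, ← Finset.sum_add_distrib]
    exact Finset.sum_congr rfl fun i _ => by ring
  have e1 : b * ∑ i, α i * k i ^ 2 * h i ^ 2 + a * ∑ i, α i * k i ^ 2 * h i = 0 := by
    rw [← hrec 1 le_rfl, Finset.mul_sum, Finset.mul_sum, ← Finset.sum_add_distrib]
    exact Finset.sum_congr rfl fun i _ => by ring
  by_cases hb : b = 0
  · by_cases ha : a = 0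
    · simp [hα, ha, hb]
    · apply mul_left_cancel₀ ha
      linear_combination (∑ i, α i * k i ^ 2 * h i) * e1 - (∑ i, α i * k i ^ 2 * h i ^ 2) * e0
  · apply mul_left_cancel₀ hb
    linear_combination (∑ i, α i * k i ^ 2 * h i) * e0 - (∑ i, α i * k i ^ 2) * e1
end

section
/- Let K be a field of characteristic zero. Let q be a quadratic form in K[x₀,x₁,x₂] which is nondegenerate (the determinant of its associated symmetric 3×3 matrix is nonzero) and such that the line x₂ = 0 is not tangent to the conic q = 0 (writing q(x₀,x₁,0) = a x₀² + b x₀x₁ + c x₁², this means b² − 4ac ≠ 0). Suppose α₁ l₁⁴ + ⋯ + α₆ l₆⁴ = x₂² q, where lᵢ = x₀ + hᵢ x₁ + kᵢ x₂ with hᵢ, kᵢ, αᵢ ∈ K for i = 1,…,6. Then every αᵢ is nonzero and the set {h₁,…,h₆} has exactly two elements. -/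
open MvPolynomial

/-- If the weighted power sums `∑ wᵢ xᵢᵃ` vanish for `a < n` and the `xᵢ` take at most `n`
values, then `∑ wᵢ f(xᵢ)` vanishes for every function `f`. -/
theorem sum_mul_apply_eq_zero_of_sum_mul_pow_eq_zero {K ι : Type*} [Field K] [DecidableEq K]
    (s : Finset ι) (w x : ι → K) (n : ℕ) (hw : ∀ a < n, ∑ i ∈ s, w i * x i ^ a = 0)
    (hn : (s.image x).card ≤ n) (f : K → K) : ∑ i ∈ s, w i * f (x i) = 0 := by
  have hinj : Set.InjOn (id : K → K) (s.image x) := Set.injOn_id _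
  set P := Lagrange.interpolate (s.image x) id f
  have hdeg : P.degree < n :=
    (Lagrange.degree_interpolate_lt f hinj).trans_le (by exact_mod_cast hn)
  have heval : ∀ i ∈ s, f (x i) = ∑ a ∈ Finset.range n, P.coeff a * x i ^ a := by
    intro i hi
    have hnat : P.natDegree < n := by
      have hpos : 0 < n := (Finset.card_pos.2 ⟨_, Finset.mem_image_of_mem x hi⟩).trans_le hn
      by_cases h0 : P = 0
      · simpa [h0] using hpos
      · exact (Polynomial.natDegree_lt_iff_degree_lt h0).2 hdeg
    rw [← Polynomial.eval_eq_sum_range' hnat]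
    exact (Lagrange.eval_interpolate_at_node f hinj (Finset.mem_image_of_mem x hi)).symm
  calc ∑ i ∈ s, w i * f (x i)
      = ∑ i ∈ s, ∑ a ∈ Finset.range n, P.coeff a * (w i * x i ^ a) := by
        refine Finset.sum_congr rfl fun i hi => ?_
        rw [heval i hi, Finset.mul_sum]
        exact Finset.sum_congr rfl fun a _ => by ring
    _ = 0 := by
        rw [Finset.sum_comm]
        refine Finset.sum_eq_zero fun a ha => ?_
        rw [← Finset.mul_sum, hw a (Finset.mem_range.1 ha), mul_zero]

/-- Under the vanishing of power sums, the weights over each fibre of `x` sum to zero. -/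
theorem sum_fiber_eq_zero_of_sum_mul_pow_eq_zero {K ι : Type*} [Field K] [DecidableEq K]
    (s : Finset ι) (w x : ι → K) (n : ℕ) (hw : ∀ a < n, ∑ i ∈ s, w i * x i ^ a = 0)
    (hn : (s.image x).card ≤ n) (v : K) : ∑ i ∈ s with x i = v, w i = 0 := by
  simpa [Finset.sum_filter] using
    sum_mul_apply_eq_zero_of_sum_mul_pow_eq_zero s w x n hw hn fun y => if y = v then 1 else 0

/-- If the power sums of order `< n` vanish but some weighted sum does not, more than `n`
weights are nonzero. -/
theorem lt_card_filter_ne_zero {K ι : Type*} [Field K] [DecidableEq K]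
    (s : Finset ι) (w x : ι → K) (n : ℕ) (hw : ∀ a < n, ∑ i ∈ s, w i * x i ^ a = 0)
    (f : K → K) (hf : ∑ i ∈ s, w i * f (x i) ≠ 0) : n < (s.filter (w · ≠ 0)).card := by
  by_contra! hle
  have hsupp : ∀ g : K → K, ∑ i ∈ s with w i ≠ 0, w i * g (x i) = ∑ i ∈ s, w i * g (x i) :=
    fun g => Finset.sum_filter_of_ne fun i _ hi => left_ne_zero_of_mul hi
  refine hf ?_
  rw [← hsupp]
  exact sum_mul_apply_eq_zero_of_sum_mul_pow_eq_zero _ w x n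
    (fun a ha => (hsupp (· ^ a)).trans (hw a ha)) (Finset.card_image_le.trans hle) f

theorem coeff_X_pow_mul_X_pow_mul_X_pow {K : Type*} [CommSemiring K] (a b c i j l : ℕ) :
    coeff (Finsupp.single 0 a + Finsupp.single 1 b + Finsupp.single 2 c)
      (X 0 ^ i * X 1 ^ j * X 2 ^ l : MvPolynomial (Fin 3) K) =
      if i = a ∧ j = b ∧ l = c then 1 else 0 := by
  rw [X_pow_eq_monomial, X_pow_eq_monomial, X_pow_eq_monomial, monomial_mul, monomial_mul,
    coeff_monomial]
  simp only [mul_one]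
  congr 1
  simp [Finsupp.ext_iff, Fin.forall_fin_succ]

theorem coeff_linear_pow_four {K : Type*} [Field K] (h k : K) (a b : ℕ)
    (hab : a + b ≤ 4) :
    coeff (Finsupp.single 0 (4 - a - b) + Finsupp.single 1 a + Finsupp.single 2 b)
      ((X 0 + C h * X 1 + C k * X 2) ^ 4 : MvPolynomial (Fin 3) K) =
      (Nat.choose 4 b * Nat.choose (4 - b) a : ℕ) * (h ^ a * k ^ b) := by
  have hexp : ((X 0 + C h * X 1 + C k * X 2) ^ 4 : MvPolynomial (Fin 3) K) =
      ∑ b ∈ Finset.range 5, ∑ a ∈ Finset.range (5 - b),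
        C ((Nat.choose 4 b * Nat.choose (4 - b) a : ℕ) * (h ^ a * k ^ b)) *
          (X 0 ^ (4 - a - b) * X 1 ^ a * X 2 ^ b) := by
    simp [Finset.sum_range_succ, Nat.choose]
    ring
  rw [hexp]
  simp only [coeff_sum, coeff_C_mul, coeff_X_pow_mul_X_pow_mul_X_pow]
  rw [Finset.sum_eq_single b, Finset.sum_eq_single a]
  · simp
  · intro c _ hc
    simp [hc]
  · intro hn
    simp only [Finset.mem_range] at hn
    omega
  · intro c _ hc
    simp [hc]
  · intro hn
    simp only [Finset.mem_range] at hn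
    omega

/-- If the `hᵢ` are pairwise distinct and the moments of order zero and one in `k` vanish, then
the moments of order two in `k` vanish as well. -/
theorem second_moments_eq_zero_of_injective {K : Type*} [Field K] [DecidableEq K]
    (h k α : Fin 6 → K) (hh : Function.Injective h)
    (m0 : ∀ a < 5, ∑ i, α i * h i ^ a = 0) (m1 : ∀ a < 4, ∑ i, α i * k i * h i ^ a = 0)
    {a : ℕ} (ha : a < 3) : ∑ i, α i * k i ^ 2 * h i ^ a = 0 := by
  obtain ⟨c, d, h0, h1⟩ : ∃ c d : K, k 0 = c + d * h 0 ∧ k 1 = c + d * h 1 := by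
    have hne : h 1 - h 0 ≠ 0 := sub_ne_zero.2 (hh.ne (by decide))
    refine ⟨k 0 - (k 1 - k 0) / (h 1 - h 0) * h 0, (k 1 - k 0) / (h 1 - h 0), by ring, ?_⟩
    field_simp
    ring
  set β : Fin 6 → K := fun i => α i * (k i - (c + d * h i)) with hβ
  have hβ0 : ∀ i, i ∉ ({0, 1}ᶜ : Finset (Fin 6)) → β i = 0 := by
    intro i hi
    simp only [Finset.mem_compl, not_not, Finset.mem_insert, Finset.mem_singleton] at hi
    rcases hi with rfl | rfl
    · simp [hβ, h0]
    · simp [hβ, h1]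
  have hβpow : ∀ a < 4, ∑ i ∈ ({0, 1}ᶜ : Finset (Fin 6)), β i * h i ^ a = 0 := by
    intro a ha
    rw [Finset.sum_subset (Finset.subset_univ _) fun i _ hi => by rw [hβ0 i hi, zero_mul]]
    have e : ∀ i, β i * h i ^ a =
        α i * k i * h i ^ a - c * (α i * h i ^ a) - d * (α i * h i ^ (a + 1)) := by
      intro i
      simp only [hβ]
      ring
    simp only [e, Finset.sum_sub_distrib, ← Finset.mul_sum]
    rw [m1 a ha, m0 a (by omega), m0 (a + 1) (by omega)]
    ring
  have hβall : ∀ i, β i = 0 := by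
    intro i
    by_cases hi : i ∈ ({0, 1}ᶜ : Finset (Fin 6))
    · have hcard : (({0, 1}ᶜ : Finset (Fin 6)).image h).card ≤ 4 :=
        Finset.card_image_le.trans (by decide)
      have hfib := sum_fiber_eq_zero_of_sum_mul_pow_eq_zero _ β h 4 hβpow hcard (h i)
      simpa only [hh.eq_iff, Finset.filter_eq', if_pos hi, Finset.sum_singleton] using hfib
    · exact hβ0 i hi
  have e : ∀ i, α i * k i ^ 2 * h i ^ a = c ^ 2 * (α i * h i ^ a) +
      2 * c * d * (α i * h i ^ (a + 1)) + d ^ 2 * (α i * h i ^ (a + 2)) := by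
    intro i
    have hi : α i * (k i - (c + d * h i)) = 0 := hβall i
    linear_combination (k i + (c + d * h i)) * h i ^ a * hi
  simp only [e, Finset.sum_add_distrib, ← Finset.mul_sum]
  rw [m0 a (by omega), m0 (a + 1) (by omega), m0 (a + 2) (by omega)]
  ring

/-- Two distinct fibres of `h` with nonzero second moment exist unless the binary form with
the given second moments has vanishing discriminant. -/
theorem exists_two_fibers_of_discrim_ne_zero {K ι : Type*} [Field K] [DecidableEq K] [Fintype ι]
    (h w : ι → K)
    (hd : (∑ i, w i * h i ^ 1) ^ 2 - (∑ i, w i * h i ^ 0) * ∑ i, w i * h i ^ 2 ≠ 0) :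
    ∃ u v, u ≠ v ∧ (∑ i with h i = u, w i) ≠ 0 ∧ (∑ i with h i = v, w i) ≠ 0 := by
  have key : ∀ v, ∃ u, u ≠ v ∧ (∑ i with h i = u, w i) ≠ 0 := by
    intro v
    by_contra! hv
    have hm : ∀ a, ∑ i, w i * h i ^ a = (∑ i with h i = v, w i) * v ^ a := by
      intro a
      have hfib : ∀ u, ∑ i with h i = u, w i * h i ^ a = (∑ i with h i = u, w i) * u ^ a := by
        intro u
        rw [Finset.sum_mul]
        exact Finset.sum_congr rfl fun i hi => by rw [(Finset.mem_filter.1 hi).2]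
      rw [← Finset.sum_fiberwise_of_maps_to (t := insert v (Finset.univ.image h)) (g := h)
        fun i _ => Finset.mem_insert_of_mem (Finset.mem_image_of_mem h (Finset.mem_univ i))]
      rw [Finset.sum_eq_single v, hfib]
      · intro u _ hu
        rw [hfib, hv u hu, zero_mul]
      · exact fun hn => (hn (Finset.mem_insert_self _ _)).elim
    apply hd
    rw [hm, hm, hm]
    ring
  obtain ⟨u, -, hu⟩ := key 0
  obtain ⟨v, hvu, hv⟩ := key u
  exact ⟨u, v, hvu.symm, hu, hv⟩

/-- The combinatorial core: the conditions on moments force all weights to be nonzero and `h` to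
take exactly two values. -/
theorem weights_ne_zero_and_card_image_eq_two {K : Type*} [Field K] [DecidableEq K]
    (h k α : Fin 6 → K)
    (m0 : ∀ a < 5, ∑ i, α i * h i ^ a = 0) (m1 : ∀ a < 4, ∑ i, α i * k i * h i ^ a = 0)
    (hd : (∑ i, α i * k i ^ 2 * h i ^ 1) ^ 2 -
      (∑ i, α i * k i ^ 2 * h i ^ 0) * ∑ i, α i * k i ^ 2 * h i ^ 2 ≠ 0) :
    (∀ i, α i ≠ 0) ∧ (Finset.univ.image h).card = 2 := by
  obtain ⟨u, v, huv, hu, hv⟩ := exists_two_fibers_of_discrim_ne_zero h (fun i => α i * k i ^ 2) hd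
  have hcard5 : (Finset.univ.image h).card ≤ 5 := by
    by_contra! hlt
    have hinj : Function.Injective h := by
      rw [← Set.injOn_univ, ← Finset.coe_univ, ← Finset.card_image_iff]
      exact le_antisymm Finset.card_image_le (by rwa [Finset.card_univ, Fintype.card_fin])
    apply hd
    simp only [second_moments_eq_zero_of_injective h k α hinj m0 m1 (by norm_num : 1 < 3),
      second_moments_eq_zero_of_injective h k α hinj m0 m1 (by norm_num : 0 < 3)]
    ring
  have f0 := sum_fiber_eq_zero_of_sum_mul_pow_eq_zero Finset.univ α h 5 m0 hcard5
  have hfiber1 : ∀ y, (∑ i with h i = y, α i * k i ^ 2) ≠ 0 →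
      1 < (Finset.univ.filter (h · = y)).card := fun y hy =>
    (lt_card_filter_ne_zero _ α k 1
      (fun a ha => by simpa [Nat.lt_one_iff.1 ha] using f0 y) (· ^ 2) hy).trans_le
        (Finset.card_filter_le _ _)
  have hmem : ∀ y, (∑ i with h i = y, α i * k i ^ 2) ≠ 0 → y ∈ Finset.univ.image h := by
    intro y hy
    obtain ⟨i, hi, -⟩ := Finset.exists_ne_zero_of_sum_ne_zero hy
    exact Finset.mem_image.2 ⟨i, Finset.mem_univ i, (Finset.mem_filter.1 hi).2⟩
  have hcard4 : (Finset.univ.image h).card ≤ 4 := by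
    have hsum := Finset.card_eq_sum_card_image h Finset.univ
    have hsub : ({u, v} : Finset K) ⊆ Finset.univ.image h := by
      simp only [Finset.insert_subset_iff, Finset.singleton_subset_iff]
      exact ⟨hmem u hu, hmem v hv⟩
    rw [← Finset.sum_sdiff hsub, Finset.sum_pair huv, Finset.card_univ, Fintype.card_fin] at hsum
    have hge : (Finset.univ.image h \ {u, v}).card ≤
        ∑ y ∈ Finset.univ.image h \ {u, v}, (Finset.univ.filter (h · = y)).card := by
      rw [Finset.card_eq_sum_ones]
      refine Finset.sum_le_sum fun y hy => ?_
      obtain ⟨i, -, rfl⟩ := Finset.mem_image.1 (Finset.mem_sdiff.1 hy).1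
      exact Finset.card_pos.2 ⟨i, by simp⟩
    rw [Finset.card_sdiff_of_subset hsub, Finset.card_pair huv] at hge
    have := hfiber1 u hu
    have := hfiber1 v hv
    omega
  have f1 := sum_fiber_eq_zero_of_sum_mul_pow_eq_zero Finset.univ (fun i => α i * k i) h 4 m1 hcard4
  have hfiber2 : ∀ y, (∑ i with h i = y, α i * k i ^ 2) ≠ 0 →
      2 < ((Finset.univ.filter (h · = y)).filter (α · ≠ 0)).card := fun y hy =>
    lt_card_filter_ne_zero _ α k 2
      (fun a ha => by
        interval_cases a
        · simpa using f0 y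
        · simpa using f1 y) (· ^ 2) hy
  have hdisj : Disjoint ((Finset.univ.filter (h · = u)).filter (α · ≠ 0))
      ((Finset.univ.filter (h · = v)).filter (α · ≠ 0)) := by
    rw [Finset.disjoint_left]
    intro i hi hi'
    simp only [Finset.mem_filter] at hi hi'
    exact huv (hi.1.2.symm.trans hi'.1.2)
  have hunion := (Finset.card_eq_iff_eq_univ _).1 (le_antisymm (Finset.card_le_univ _) (by
    rw [Finset.card_union_of_disjoint hdisj, Fintype.card_fin]
    have := hfiber2 u hu
    have := hfiber2 v hv
    omega))
  have hall : ∀ i, (h i = u ∨ h i = v) ∧ α i ≠ 0 := by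
    intro i
    have hi := Finset.mem_univ i
    rw [← hunion] at hi
    simp only [Finset.mem_union, Finset.mem_filter, Finset.mem_univ, true_and] at hi
    tauto
  refine ⟨fun i => (hall i).2, ?_⟩
  rw [← Finset.card_pair huv]
  congr 1
  apply Finset.Subset.antisymm
  · intro y hy
    obtain ⟨i, -, rfl⟩ := Finset.mem_image.1 hy
    simpa using (hall i).1
  · simp only [Finset.insert_subset_iff, Finset.singleton_subset_iff]
    exact ⟨hmem u hu, hmem v hv⟩

/-- if `q` is a nondegenerate quadratic form whose conic is not tangent to
the line `x₂ = 0`, and `α₁l₁⁴ + ⋯ + α₆l₆⁴ = x₂²q` with `lᵢ = x₀ + hᵢx₁ + kᵢx₂`, then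
all `αᵢ` are nonzero and the set `{h₁,…,h₆}` has exactly two elements. -/
theorem stmt_2 (K : Type*) [Field K] [CharZero K] [DecidableEq K]
    (q : MvPolynomial (Fin 3) K) (hq : q.IsHomogeneous 2)
    (hnd : (Matrix.of fun i j : Fin 3 =>
        if i = j then coeff (Finsupp.single i 2) q
        else coeff (Finsupp.single i 1 + Finsupp.single j 1) q / 2).det ≠ 0)
    (hnt : (coeff (Finsupp.single 0 1 + Finsupp.single 1 1) q) ^ 2 -
        4 * coeff (Finsupp.single 0 2) q * coeff (Finsupp.single 1 2) q ≠ 0)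
    (h k α : Fin 6 → K)
    (heq : ∑ i, C (α i) * (X 0 + C (h i) * X 1 + C (k i) * X 2) ^ 4
        = X 2 ^ 2 * q) :
    (∀ i, α i ≠ 0) ∧ (Finset.univ.image h).card = 2 := by
  have hcoeff : ∀ a b : ℕ, a + b ≤ 4 →
      (Nat.choose 4 b * Nat.choose (4 - b) a : ℕ) * ∑ i, α i * k i ^ b * h i ^ a =
      coeff (Finsupp.single 0 (4 - a - b) + Finsupp.single 1 a + Finsupp.single 2 b)
        (X 2 ^ 2 * q) := by
    intro a b hab
    rw [← heq, coeff_sum, Finset.mul_sum]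
    refine Finset.sum_congr rfl fun i _ => ?_
    rw [coeff_C_mul, coeff_linear_pow_four _ _ _ _ hab]
    ring
  have hlow : ∀ a b : ℕ, a + b ≤ 4 → b < 2 → ∑ i, α i * k i ^ b * h i ^ a = 0 := by
    intro a b hab hb
    have hne : ((Nat.choose 4 b * Nat.choose (4 - b) a : ℕ) : K) ≠ 0 :=
      Nat.cast_ne_zero.2 (Nat.mul_pos (Nat.choose_pos (by omega)) (Nat.choose_pos (by omega))).ne'
    refine (mul_eq_zero.1 ((hcoeff a b hab).trans ?_)).resolve_left hne
    rw [X_pow_eq_monomial, coeff_monomial_mul', if_neg]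
    intro hle
    have := hle 2
    simp at this
    omega
  have htwo : ∀ a : ℕ, a ≤ 2 → (6 * Nat.choose 2 a : ℕ) * ∑ i, α i * k i ^ 2 * h i ^ a =
      coeff (Finsupp.single 0 (2 - a) + Finsupp.single 1 a) q := by
    intro a ha
    have hc := hcoeff a 2 (by omega)
    rw [X_pow_eq_monomial, add_comm, coeff_monomial_mul, one_mul] at hc
    rw [show 2 - a = 4 - a - 2 by omega, ← hc]
    rfl
  have h0 := htwo 0 (by norm_num)
  have h1 := htwo 1 (by norm_num)
  have h2 := htwo 2 (by norm_num)
  norm_num at h0 h1 h2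
  refine weights_ne_zero_and_card_image_eq_two h k α
    (fun a ha => by simpa using hlow a 0 (by omega) (by norm_num))
    (fun a ha => by simpa using hlow a 1 (by omega) (by norm_num)) fun hd => hnt ?_
  rw [← h0, ← h1, ← h2]
  norm_num at hd
  linear_combination 144 * hd
end

section
/- Let K be a field of characteristic zero. Let q be a quadratic form in K[x₀,x₁,x₂] which is nondegenerate (the determinant of its associated symmetric 3×3 matrix is nonzero) and such that the line x₂ = 0 is not tangent to the conic q = 0 (writing q(x₀,x₁,0) = a x₀² + b x₀x₁ + c x₁², this means b² − 4ac ≠ 0). Suppose α₁ l₁⁴ + ⋯ + α₆ l₆⁴ = x₂² q, where lᵢ = x₀ + hᵢ x₁ + kᵢ x₂ with hᵢ, kᵢ, αᵢ ∈ K for i = 1,…,6. Then the multiset {h₁,…,h₆} consists of exactly two distinct values, each occurring exactly three times. -/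
open MvPolynomial

/-- The exponent vector `(a, b, c)`. -/
noncomputable def expVec (a b c : ℕ) : Fin 3 →₀ ℕ :=
  Finsupp.single 0 a + Finsupp.single 1 b + Finsupp.single 2 c

theorem expVec_inj {a b c a' b' c' : ℕ} :
    expVec a b c = expVec a' b' c' ↔ a = a' ∧ b = b' ∧ c = c' := by
  simp [expVec, Finsupp.ext_iff, Fin.forall_fin_succ]

theorem coeff_expVec {K : Type*} [Field K] (a b c a' b' c' : ℕ) (r : K) :
    coeff (expVec a b c) (C r * (X 0 ^ a' * X 1 ^ b' * X 2 ^ c')) =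
      if a' = a ∧ b' = b ∧ c' = c then r else 0 := by
  have : (X 0 ^ a' * X 1 ^ b' * X 2 ^ c' : MvPolynomial (Fin 3) K) =
      monomial (expVec a' b' c') 1 := by
    simp [X_pow_eq_monomial, monomial_mul, expVec]
  rw [this, C_mul_monomial, coeff_monomial]
  simp [expVec_inj]

theorem linear_pow_four {K : Type*} [Field K] (r h k : K) :
    (C r * (X 0 + C h * X 1 + C k * X 2) ^ 4 : MvPolynomial (Fin 3) K) =
      C r * (X 0 ^ 4 * X 1 ^ 0 * X 2 ^ 0) + C (4 * r * h) * (X 0 ^ 3 * X 1 ^ 1 * X 2 ^ 0) +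
      C (6 * r * h ^ 2) * (X 0 ^ 2 * X 1 ^ 2 * X 2 ^ 0) +
      C (4 * r * h ^ 3) * (X 0 ^ 1 * X 1 ^ 3 * X 2 ^ 0) +
      C (r * h ^ 4) * (X 0 ^ 0 * X 1 ^ 4 * X 2 ^ 0) +
      C (4 * r * k) * (X 0 ^ 3 * X 1 ^ 0 * X 2 ^ 1) +
      C (12 * r * k * h) * (X 0 ^ 2 * X 1 ^ 1 * X 2 ^ 1) +
      C (12 * r * k * h ^ 2) * (X 0 ^ 1 * X 1 ^ 2 * X 2 ^ 1) +
      C (4 * r * k * h ^ 3) * (X 0 ^ 0 * X 1 ^ 3 * X 2 ^ 1) +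
      C (6 * r * k ^ 2) * (X 0 ^ 2 * X 1 ^ 0 * X 2 ^ 2) +
      C (12 * r * k ^ 2 * h) * (X 0 ^ 1 * X 1 ^ 1 * X 2 ^ 2) +
      C (6 * r * k ^ 2 * h ^ 2) * (X 0 ^ 0 * X 1 ^ 2 * X 2 ^ 2) +
      C (4 * r * k ^ 3) * (X 0 ^ 1 * X 1 ^ 0 * X 2 ^ 3) +
      C (4 * r * k ^ 3 * h) * (X 0 ^ 0 * X 1 ^ 1 * X 2 ^ 3) +
      C (r * k ^ 4) * (X 0 ^ 0 * X 1 ^ 0 * X 2 ^ 4) := by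
  simp only [C_mul, C_pow, map_ofNat]
  ring

theorem coeff_X_two_sq_mul {K : Type*} [Field K] (q : MvPolynomial (Fin 3) K) (a b c : ℕ) :
    coeff (expVec a b c) (X 2 ^ 2 * q) =
      if 2 ≤ c then coeff (expVec a b (c - 2)) q else 0 := by
  rw [X_pow_eq_monomial, coeff_monomial_mul', one_mul]
  have h1 : Finsupp.single 2 2 ≤ expVec a b c ↔ 2 ≤ c := by
    simp [expVec]
  have h2 : expVec a b c - Finsupp.single 2 2 = expVec a b (c - 2) := by
    ext i
    fin_cases i <;> simp [expVec]
  rw [h2]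
  simp only [h1]

/-- The weights of a relation between at most `n` distinct points, killing all polynomials of
degree less than `n`, vanish. -/
theorem eq_zero_of_moments_eq_zero {K : Type*} [Field K] [DecidableEq K] (S : Finset K) (A : K → K)
    (n : ℕ) (hS : S.card ≤ n) (hA : ∀ j < n, ∑ v ∈ S, A v * v ^ j = 0) :
    ∀ v ∈ S, A v = 0 := by
  intro w hw
  set p : Polynomial K := ∏ u ∈ S.erase w, (Polynomial.X - Polynomial.C u) with hp
  have hdeg : p.natDegree < n := by
    rw [hp, Polynomial.natDegree_finsetProd_X_sub_C_eq_card, Finset.card_erase_of_mem hw]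
    have := Finset.card_pos.2 ⟨w, hw⟩
    omega
  have hsum : ∑ v ∈ S, A v * p.eval v = 0 := by
    simp only [Polynomial.eval_eq_sum_range' hdeg, Finset.mul_sum]
    rw [Finset.sum_comm]
    refine Finset.sum_eq_zero fun j hj => ?_
    have := congrArg (p.coeff j * ·) (hA j (Finset.mem_range.1 hj))
    simp only [Finset.mul_sum, mul_zero] at this
    rw [← this]
    exact Finset.sum_congr rfl fun v _ => by ring
  rw [Finset.sum_eq_single w, mul_eq_zero] at hsum
  · refine hsum.resolve_right ?_
    rw [hp, Polynomial.eval_prod, ← ne_eq, Finset.prod_ne_zero_iff]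
    intro u hu
    simpa [sub_eq_zero] using (Finset.ne_of_mem_erase hu).symm
  · intro v hv hvw
    rw [hp, Polynomial.eval_prod, Finset.prod_eq_zero (Finset.mem_erase.2 ⟨hvw, hv⟩) (by simp),
      mul_zero]
  · exact fun h => absurd hw h

theorem sum_mul_eq_zero_of_card_le_one {ι K : Type*} [Field K] (G : Finset ι) (α k : ι → K)
    (hG : G.card ≤ 1) (hα : ∑ i ∈ G, α i = 0) : ∑ i ∈ G, α i * k i = 0 := by
  refine Finset.sum_eq_zero fun i hi => ?_
  have hGi : G = {i} := Finset.eq_singleton_iff_unique_mem.2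
    ⟨hi, fun j hj => Finset.card_le_one.1 hG j hj i hi⟩
  rw [hGi, Finset.sum_singleton] at hα
  rw [hα, zero_mul]

theorem sum_mul_sq_eq_zero_of_card_le_two {ι K : Type*} [Field K] [DecidableEq ι]
    (G : Finset ι) (α k : ι → K) (hG : G.card ≤ 2) (hα : ∑ i ∈ G, α i = 0)
    (hk : ∑ i ∈ G, α i * k i = 0) : ∑ i ∈ G, α i * k i ^ 2 = 0 := by
  rcases Nat.lt_or_ge G.card 2 with h | h
  · exact sum_mul_eq_zero_of_card_le_one G α (fun i => k i ^ 2) (by omega) hα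
  · obtain ⟨i, j, hij, rfl⟩ := Finset.card_eq_two.1 (le_antisymm hG h)
    rw [Finset.sum_pair hij] at *
    linear_combination (k i + k j) * hk - k i * k j * hα

section Fibers

variable {ι K : Type*} [Fintype ι] [Field K] [DecidableEq K]

theorem sum_mul_pow_eq_sum_fiber (h f : ι → K) (j : ℕ) :
    ∑ i, f i * h i ^ j =
      ∑ v ∈ Finset.univ.image h, (∑ i with h i = v, f i) * v ^ j := by
  rw [← Finset.sum_fiberwise_of_maps_to (g := h) (t := Finset.univ.image h) (by simp)]
  refine Finset.sum_congr rfl fun v _ => ?_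
  rw [Finset.sum_mul]
  refine Finset.sum_congr rfl fun i hi => ?_
  rw [(Finset.mem_filter.1 hi).2]

/-- If `h` takes at most five values, then the sums of the weights `α` and `α * k`
vanish on every fibre of `h`. -/
theorem fiber_sums_eq_zero (hι : Fintype.card ι = 6) (h k α : ι → K)
    (hS : (Finset.univ.image h).card ≤ 5)
    (h0 : ∀ j < 5, ∑ i, α i * h i ^ j = 0) (h1 : ∀ j < 4, ∑ i, α i * k i * h i ^ j = 0) (v : K) :
    ∑ i with h i = v, α i = 0 ∧ ∑ i with h i = v, α i * k i = 0 := by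
  classical
  by_cases hv : v ∈ Finset.univ.image h
  swap
  · have : Finset.univ.filter (fun i => h i = v) = ∅ :=
      Finset.filter_eq_empty_iff.2 fun i _ hi => hv (hi ▸ Finset.mem_image_of_mem h (by simp))
    simp [this]
  have hA := eq_zero_of_moments_eq_zero _ (fun v => ∑ i with h i = v, α i) 5 hS
    fun j hj => by rw [← sum_mul_pow_eq_sum_fiber, h0 j hj]
  refine ⟨hA v hv, ?_⟩
  set S' := (Finset.univ.image h).filter fun v => 2 ≤ (Finset.univ.filter fun i => h i = v).card
    with hS'
  have hsingle : ∀ v ∈ Finset.univ.image h, v ∉ S' → ∑ i with h i = v, α i * k i = 0 := by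
    intro v hv hvS
    refine sum_mul_eq_zero_of_card_le_one _ _ _ ?_ (hA v hv)
    by_contra hc
    exact hvS (Finset.mem_filter.2 ⟨hv, by omega⟩)
  by_cases hvS : v ∈ S'
  swap
  · exact hsingle v hv hvS
  refine eq_zero_of_moments_eq_zero S' (fun v => ∑ i with h i = v, α i * k i) 4 ?_ ?_ v hvS
  · have hcard : Fintype.card ι =
        ∑ v ∈ Finset.univ.image h, (Finset.univ.filter fun i => h i = v).card :=
      Finset.card_eq_sum_card_image h Finset.univ
    have hsub : ∑ v ∈ S', (Finset.univ.filter fun i => h i = v).card ≤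
        ∑ v ∈ Finset.univ.image h, (Finset.univ.filter fun i => h i = v).card :=
      Finset.sum_le_sum_of_subset (Finset.filter_subset _ _)
    have hlow := Finset.card_nsmul_le_sum S'
      (fun v => (Finset.univ.filter fun i => h i = v).card) 2
      fun v hv => (Finset.mem_filter.1 hv).2
    simp only [smul_eq_mul] at hlow
    omega
  · intro j hj
    rw [← h1 j hj, sum_mul_pow_eq_sum_fiber]
    refine Finset.sum_subset (Finset.filter_subset _ _) fun v hv hvS => ?_
    simp only [hsingle v hv hvS, zero_mul]

/-- If the six values `h i` are distinct, the second moments vanish: the `k i` with nonzero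
weight are an affine function of the `h i`. -/
theorem second_moments_eq_zero_of_injective_s3 (hι : Fintype.card ι = 6) (h k α : ι → K)
    (hinj : Function.Injective h)
    (h1 : ∀ j < 4, ∑ i, α i * k i * h i ^ j = 0) (h0 : ∀ j < 5, ∑ i, α i * h i ^ j = 0) (j : ℕ)
    (hj : j < 3) : ∑ i, α i * k i ^ 2 * h i ^ j = 0 := by
  classical
  obtain ⟨x, y, hxy⟩ := Fintype.exists_pair_of_one_lt_card (α := ι) (by omega)
  have hne : h x - h y ≠ 0 := sub_ne_zero.2 (hinj.ne hxy)
  set d := (k x - k y) / (h x - h y) with hd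
  have hd' : d * (h x - h y) = k x - k y := div_mul_cancel₀ _ hne
  set c := k x - d * h x with hc
  set E : ι → K := fun i => α i * (k i - c - d * h i) with hE
  have hEx : E x = 0 := by simp [hE, hc]
  have hEy : E y = 0 := by
    have : k y - c - d * h y = 0 := by rw [hc]; linear_combination hd'
    simp [hE, this]
  have hfib : ∀ i, ∑ l with h l = h i, E l = E i := by
    intro i
    have : Finset.univ.filter (fun l => h l = h i) = {i} := by
      ext l; simp [hinj.eq_iff]
    rw [this, Finset.sum_singleton]
  have hmom : ∀ j < 4, ∑ i, E i * h i ^ j = 0 := by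
    intro j hj
    have : ∑ i, E i * h i ^ j = ∑ i, α i * k i * h i ^ j - c * ∑ i, α i * h i ^ j
        - d * ∑ i, α i * h i ^ (j + 1) := by
      simp only [Finset.mul_sum, ← Finset.sum_sub_distrib]
      exact Finset.sum_congr rfl fun i _ => by simp only [hE]; ring
    rw [this, h1 j hj, h0 j (by omega), h0 (j + 1) (by omega)]
    ring
  have hzero : ∀ i, E i = 0 := by
    intro i
    by_cases hix : i = x
    · rw [hix, hEx]
    by_cases hiy : i = y
    · rw [hiy, hEy]
    have key := eq_zero_of_moments_eq_zero (((Finset.univ.erase x).erase y).image h)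
      (fun v => ∑ l with h l = v, E l) 4 ?_ ?_ (h i)
      (Finset.mem_image_of_mem h (by simp [hix, hiy]))
    · rwa [← hfib i]
    · rw [Finset.card_image_of_injective _ hinj, Finset.card_erase_of_mem (by simp [hxy.symm]),
        Finset.card_erase_of_mem (by simp), Finset.card_univ, hι]
    · intro j hj
      rw [Finset.sum_image hinj.injOn, ← hmom j hj]
      simp only [hfib]
      rw [Finset.sum_erase _ (by rw [hEy, zero_mul]), Finset.sum_erase _ (by rw [hEx, zero_mul])]
  have hsq : ∑ i, α i * k i ^ 2 * h i ^ j =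
      c * ∑ i, α i * k i * h i ^ j + d * ∑ i, α i * k i * h i ^ (j + 1) := by
    simp only [Finset.mul_sum, ← Finset.sum_add_distrib]
    refine Finset.sum_congr rfl fun i _ => ?_
    have := hzero i
    simp only [hE] at this
    linear_combination (k i * h i ^ j) * this
  rw [hsq, h1 j (by omega), h1 (j + 1) (by omega)]
  ring

theorem exists_two_fibers_of_card_three (hι : Fintype.card ι = 6) (h k α : ι → K)
    (h0 : ∀ j < 5, ∑ i, α i * h i ^ j = 0) (h1 : ∀ j < 4, ∑ i, α i * k i * h i ^ j = 0)
    (h2 : (∑ i, α i * k i ^ 2 * h i ^ 1) ^ 2 ≠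
      (∑ i, α i * k i ^ 2 * h i ^ 0) * ∑ i, α i * k i ^ 2 * h i ^ 2) :
    ∃ a b : K, a ≠ b ∧ (Finset.univ.filter fun i => h i = a).card = 3 ∧
      (Finset.univ.filter fun i => h i = b).card = 3 := by
  classical
  by_cases hS : (Finset.univ.image h).card ≤ 5
  swap
  · have hle : (Finset.univ.image h).card ≤ Fintype.card ι := Finset.card_image_le
    have hinj : Function.Injective h := by
      rw [← Set.injOn_univ, ← Finset.coe_univ]
      exact Finset.card_image_iff.1 (by rw [Finset.card_univ]; omega)
    have hz := second_moments_eq_zero_of_injective_s3 hι h k α hinj h1 h0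
    exact absurd (by rw [hz 0 (by omega), hz 1 (by omega)]; ring) h2
  have hAB := fiber_sums_eq_zero hι h k α hS h0 h1
  set D : K → K := fun v => ∑ i with h i = v, α i * k i ^ 2 with hD
  have hD3 : ∀ v, D v ≠ 0 → 3 ≤ (Finset.univ.filter fun i => h i = v).card := by
    intro v hv
    by_contra hc
    exact hv (sum_mul_sq_eq_zero_of_card_le_two _ _ _ (by omega) (hAB v).1 (hAB v).2)
  have hpair : ∃ a b, a ≠ b ∧ D a ≠ 0 ∧ D b ≠ 0 := by
    by_contra! hno
    refine h2 ?_
    by_cases hex : ∃ a ∈ Finset.univ.image h, D a ≠ 0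
    · obtain ⟨a, haS, ha⟩ := hex
      have hs : ∀ j, ∑ i, α i * k i ^ 2 * h i ^ j = D a * a ^ j := by
        intro j
        rw [sum_mul_pow_eq_sum_fiber]
        refine Finset.sum_eq_single_of_mem a haS fun b _ hb => ?_
        have := hno a b hb.symm ha
        simp only [hD] at this
        rw [this, zero_mul]
      rw [hs, hs, hs]; ring
    · push Not at hex
      have hs : ∀ j, ∑ i, α i * k i ^ 2 * h i ^ j = 0 := by
        intro j
        rw [sum_mul_pow_eq_sum_fiber]
        refine Finset.sum_eq_zero fun b hb => ?_
        have := hex b hb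
        simp only [hD] at this
        rw [this, zero_mul]
      rw [hs, hs, hs]; ring
  obtain ⟨a, b, hab, ha, hb⟩ := hpair
  have hle : (Finset.univ.filter fun i => h i = a).card +
      (Finset.univ.filter fun i => h i = b).card ≤ Fintype.card ι := by
    rw [← Finset.card_union_of_disjoint]
    · exact Finset.card_le_univ _
    · exact Finset.disjoint_filter.2 fun i _ hia hib => hab (hia.symm.trans hib)
  have := hD3 a ha
  have := hD3 b hb
  exact ⟨a, b, hab, by omega, by omega⟩

end Fibers



/-- if `q` is a nondegenerate quadratic form whose conic is not tangent to
the line `x₂ = 0`, and `α₁l₁⁴ + ⋯ + α₆l₆⁴ = x₂²q` with `lᵢ = x₀ + hᵢx₁ + kᵢx₂`, then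
the multiset `{h₁,…,h₆}` consists of exactly two distinct values, each occurring
exactly three times. -/
theorem stmt_3 (K : Type*) [Field K] [CharZero K] [DecidableEq K]
    (q : MvPolynomial (Fin 3) K) (hq : q.IsHomogeneous 2)
    (hnd : (Matrix.of fun i j : Fin 3 =>
        if i = j then coeff (Finsupp.single i 2) q
        else coeff (Finsupp.single i 1 + Finsupp.single j 1) q / 2).det ≠ 0)
    (hnt : (coeff (Finsupp.single 0 1 + Finsupp.single 1 1) q) ^ 2 -
        4 * coeff (Finsupp.single 0 2) q * coeff (Finsupp.single 1 2) q ≠ 0)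
    (h k α : Fin 6 → K)
    (heq : ∑ i, C (α i) * (X 0 + C (h i) * X 1 + C (k i) * X 2) ^ 4
        = X 2 ^ 2 * q) :
    ∃ a b : K, a ≠ b ∧
      (Finset.univ.filter fun i => h i = a).card = 3 ∧
      (Finset.univ.filter fun i => h i = b).card = 3 := by
  have hcoeff : ∀ a b c : ℕ,
      ∑ i, coeff (expVec a b c) (C (α i) * (X 0 + C (h i) * X 1 + C (k i) * X 2) ^ 4) =
        if 2 ≤ c then coeff (expVec a b (c - 2)) q else 0 := by
    intro a b c
    rw [← coeff_X_two_sq_mul, ← heq, coeff_sum]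
  simp only [linear_pow_four, coeff_add, coeff_expVec] at hcoeff
  have e1 : expVec 1 1 0 = Finsupp.single 0 1 + Finsupp.single 1 1 := by simp [expVec]
  have e0 : expVec 2 0 0 = Finsupp.single 0 2 := by simp [expVec]
  have e2 : expVec 0 2 0 = Finsupp.single 1 2 := by simp [expVec]
  rw [← e1, ← e0, ← e2] at hnt
  have c40 := hcoeff 4 0 0
  have c31 := hcoeff 3 1 0
  have c22 := hcoeff 2 2 0
  have c13 := hcoeff 1 3 0
  have c04 := hcoeff 0 4 0
  have d30 := hcoeff 3 0 1
  have d21 := hcoeff 2 1 1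
  have d12 := hcoeff 1 2 1
  have d03 := hcoeff 0 3 1
  have s20 := hcoeff 2 0 2
  have s11 := hcoeff 1 1 2
  have s02 := hcoeff 0 2 2
  simp [mul_assoc, ← Finset.mul_sum] at c40 c31 c22 c13 c04 d30 d21 d12 d03 s20 s11 s02
  refine exists_two_fibers_of_card_three (by simp) h k α ?_ ?_ ?_
  · intro j hj
    interval_cases j <;> simpa
  · intro j hj
    interval_cases j <;> simpa [mul_assoc]
  · intro hs
    simp only [pow_zero, pow_one, mul_one, mul_assoc] at hs
    refine hnt ?_
    rw [← s20, ← s11, ← s02]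
    linear_combination 144 * hs
end

section
/- Let K be a field of characteristic zero. Let h₁,…,h₆ ∈ K be pairwise distinct, let k₁,…,k₆, α₁,…,α₆ ∈ K, and set lᵢ = x₀ + hᵢ x₁ + kᵢ x₂ ∈ K[x₀,x₁,x₂]. If α₁ l₁⁴ + ⋯ + α₆ l₆⁴ = x₂² q for some quadratic form q ∈ K[x₀,x₁,x₂], then q = 0 (and hence α₁ l₁⁴ + ⋯ + α₆ l₆⁴ = 0). -/
open MvPolynomial

/-- If `∑ wᵢ hᵢʲ` is zero for `j < 6` at six distinct nodes, the weights vanish. -/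
lemma weights_eq_zero_of_moments {K : Type*} [Field K] {h w : Fin 6 → K}
    (hdist : Function.Injective h) (hw : ∀ j < 6, ∑ i, w i * h i ^ j = 0) : w = 0 :=
  Matrix.eq_zero_of_forall_pow_sum_mul_pow_eq_zero hdist fun j => hw j j.isLt

/-- Any function on six distinct nodes is a polynomial of degree at most five in the nodes. -/
lemma exists_interpolation_coeffs {K : Type*} [Field K] {h : Fin 6 → K}
    (hdist : Function.Injective h) (k : Fin 6 → K) :
    ∃ c : ℕ → K, ∀ i, k i = ∑ j ∈ Finset.range 6, c j * h i ^ j := by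
  refine ⟨(Lagrange.interpolate Finset.univ h k).coeff, fun i => ?_⟩
  have hdeg := Lagrange.degree_interpolate_lt (s := Finset.univ) k hdist.injOn
  have hnat : (Lagrange.interpolate Finset.univ h k).natDegree < 6 := by
    rcases eq_or_ne (Lagrange.interpolate Finset.univ h k) 0 with h0 | h0
    · simp [h0]
    · exact (Polynomial.natDegree_lt_iff_degree_lt h0).2 (by simpa using hdeg)
  rw [← Polynomial.eval_eq_sum_range' hnat,
    Lagrange.eval_interpolate_at_node k hdist.injOn (Finset.mem_univ i)]

/-- Weights annihilating degree `≤ 4`, and whose products with `k` annihilate degree `≤ 3`,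
either vanish or force `k` to be affine in the nodes. -/
lemma weights_eq_zero_or_affine {K : Type*} [Field K] {h k w : Fin 6 → K}
    (hdist : Function.Injective h) (hw : ∀ j < 5, ∑ i, w i * h i ^ j = 0)
    (hk : ∀ j < 4, ∑ i, w i * k i * h i ^ j = 0) :
    w = 0 ∨ ∃ a b : K, ∀ i, k i = a + b * h i := by
  by_cases h5 : ∑ i, w i * h i ^ 5 = 0
  · refine Or.inl (weights_eq_zero_of_moments hdist fun j hj => ?_)
    rcases Nat.lt_succ_iff_lt_or_eq.1 hj with hj | rfl
    exacts [hw j hj, h5]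
  · right
    obtain ⟨c, hc⟩ := exists_interpolation_coeffs hdist k
    have expand (m : ℕ) (hm : m < 4) :
        ∑ j ∈ Finset.range 6, c j * ∑ i, w i * h i ^ (j + m) = 0 := by
      rw [← hk m hm]
      simp_rw [hc, Finset.mul_sum, Finset.sum_mul]
      rw [Finset.sum_comm]
      refine Finset.sum_congr rfl fun i _ => Finset.sum_congr rfl fun j _ => ?_
      ring
    have h0 : ∑ i, w i = 0 := by simpa only [pow_zero, mul_one] using hw 0 (by norm_num)
    have h1 : ∑ i, w i * h i = 0 := by simpa only [pow_one] using hw 1 (by norm_num)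
    have c5 : c 5 = 0 := by
      simpa [Finset.sum_range_succ, hw, h5, h0, h1] using expand 0
    have c4 : c 4 = 0 := by
      simpa [Finset.sum_range_succ, hw, h5, h1, c5] using expand 1
    have c3 : c 3 = 0 := by
      simpa [Finset.sum_range_succ, hw, h5, c5, c4] using expand 2
    have c2 : c 2 = 0 := by
      simpa [Finset.sum_range_succ, hw, h5, c5, c4, c3] using expand 3
    refine ⟨c 0, c 1, fun i => ?_⟩
    simp [hc i, Finset.sum_range_succ, c5, c4, c3, c2]

lemma sum_mul_add_mul_pow_four {R ι : Type*} [CommRing R] (s : Finset ι) (w h : ι → R) (u v : R) :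
    ∑ i ∈ s, w i * (u + h i * v) ^ 4 =
      (∑ i ∈ s, w i * h i ^ 0) * u ^ 4 + 4 * (∑ i ∈ s, w i * h i ^ 1) * u ^ 3 * v
      + 6 * (∑ i ∈ s, w i * h i ^ 2) * u ^ 2 * v ^ 2 + 4 * (∑ i ∈ s, w i * h i ^ 3) * u * v ^ 3
      + (∑ i ∈ s, w i * h i ^ 4) * v ^ 4 := by
  simp only [Finset.mul_sum, Finset.sum_mul, ← Finset.sum_add_distrib]
  exact Finset.sum_congr rfl fun i _ => by ring

lemma sum_mul_add_mul_pow_three {R ι : Type*} [CommRing R] (s : Finset ι) (w h : ι → R)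
    (u v : R) :
    ∑ i ∈ s, w i * (u + h i * v) ^ 3 =
      (∑ i ∈ s, w i * h i ^ 0) * u ^ 3 + 3 * (∑ i ∈ s, w i * h i ^ 1) * u ^ 2 * v
      + 3 * (∑ i ∈ s, w i * h i ^ 2) * u * v ^ 2 + (∑ i ∈ s, w i * h i ^ 3) * v ^ 3 := by
  simp only [Finset.mul_sum, Finset.sum_mul, ← Finset.sum_add_distrib]
  exact Finset.sum_congr rfl fun i _ => by ring

lemma moments_eq_zero_of_pow_four {K ι : Type*} [Field K] [CharZero K] (s : Finset ι)
    (w h : ι → K) (H : ∀ t : K, ∑ i ∈ s, w i * (1 + h i * t) ^ 4 = 0) :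
    ∀ j < 5, ∑ i ∈ s, w i * h i ^ j = 0 := by
  simp only [sum_mul_add_mul_pow_four] at H
  have e0 := H 0
  have e1 := H 1
  have e2 := H (-1)
  have e3 := H 2
  have e4 := H (-2)
  intro j hj
  interval_cases j
  · linear_combination e0
  · linear_combination (1 / 6 : K) * (e1 - e2) - (1 / 48 : K) * (e3 - e4)
  · linear_combination (1 / 9 : K) * (e1 + e2) - (1 / 144 : K) * (e3 + e4) - (5 / 24 : K) * e0
  · linear_combination (1 / 48 : K) * (e3 - e4) - (1 / 24 : K) * (e1 - e2)
  · linear_combination (1 / 24 : K) * (e3 + e4) - (1 / 6 : K) * (e1 + e2) + (1 / 4 : K) * e0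

lemma moments_eq_zero_of_pow_three {K ι : Type*} [Field K] [CharZero K] (s : Finset ι)
    (w h : ι → K) (H : ∀ t : K, ∑ i ∈ s, w i * (1 + h i * t) ^ 3 = 0) :
    ∀ j < 4, ∑ i ∈ s, w i * h i ^ j = 0 := by
  simp only [sum_mul_add_mul_pow_three] at H
  have e0 := H 0
  have e1 := H 1
  have e2 := H (-1)
  have e3 := H 2
  intro j hj
  interval_cases j
  · linear_combination e0
  · linear_combination (1 / 3 : K) * e1 - (1 / 9 : K) * e2 - (1 / 18 : K) * e3 - (1 / 6 : K) * e0
  · linear_combination (1 / 6 : K) * (e1 + e2) - (1 / 3 : K) * e0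
  · linear_combination (1 / 6 : K) * e3 - (1 / 2 : K) * e1 - (1 / 6 : K) * e2 + (1 / 2 : K) * e0

/-- If `k` is affine in `h` and the weights annihilate degree `≤ 4` in `h`, then the weighted sum
of fourth powers of the linear forms `x + hᵢ y + kᵢ z` vanishes. -/
lemma sum_pow_four_eq_zero_of_affine {K R ι : Type*} [CommRing K] [CommRing R] (f : K →+* R)
    {s : Finset ι} {w h k : ι → K} (hw : ∀ j < 5, ∑ i ∈ s, w i * h i ^ j = 0) {a b : K}
    (hk : ∀ i, k i = a + b * h i) (x y z : R) :
    ∑ i ∈ s, f (w i) * (x + f (h i) * y + f (k i) * z) ^ 4 = 0 := by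
  have hf (j : ℕ) (hj : j < 5) : ∑ i ∈ s, f (w i) * f (h i) ^ j = 0 := by
    simp_rw [← map_pow, ← map_mul, ← map_sum, hw j hj, map_zero]
  calc _ = ∑ i ∈ s, f (w i) * ((x + f a * z) + f (h i) * (y + f b * z)) ^ 4 :=
        Finset.sum_congr rfl fun i _ => by rw [hk i, map_add, map_mul]; ring
    _ = 0 := by
        rw [sum_mul_add_mul_pow_four, hf 0 (by norm_num), hf 1 (by norm_num),
          hf 2 (by norm_num), hf 3 (by norm_num), hf 4 (by norm_num)]
        ring

/-- with `h₁,…,h₆` pairwise distinct and `lᵢ = x₀ + hᵢx₁ + kᵢx₂`, if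
`α₁l₁⁴ + ⋯ + α₆l₆⁴ = x₂²q` for a quadratic form `q`, then `q = 0` (and hence the
combination itself vanishes). -/
theorem stmt_4 (K : Type*) [Field K] [CharZero K]
    (h k α : Fin 6 → K)
    (hdist : Function.Injective h)
    (q : MvPolynomial (Fin 3) K) (hq : q.IsHomogeneous 2)
    (heq : ∑ i, C (α i) * (X 0 + C (h i) * X 1 + C (k i) * X 2) ^ 4
        = X 2 ^ 2 * q) :
    q = 0 ∧ ∑ i, C (α i) * (X 0 + C (h i) * X 1 + C (k i) * X 2) ^ 4 = 0 := by
  have hα : ∀ j < 5, ∑ i, α i * h i ^ j = 0 := by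
    refine moments_eq_zero_of_pow_four _ _ _ fun t => ?_
    simpa only [map_sum, map_mul, map_add, map_pow, eval_C, eval_X, Matrix.cons_val, mul_zero,
      add_zero, ne_eq, OfNat.ofNat_ne_zero, not_false_eq_true, zero_pow, zero_mul]
      using congrArg (eval ![1, t, 0]) heq
  have hαk : ∀ j < 4, ∑ i, α i * k i * h i ^ j = 0 := by
    refine moments_eq_zero_of_pow_three _ _ _ fun t => ?_
    have hd := congrArg (fun p => eval ![1, t, 0] (pderiv 2 p)) heq
    simp [Derivation.leibniz, Derivation.leibniz_pow, pderiv_X] at hd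
    have h4 : (4 : K) ≠ 0 := by norm_num
    refine (mul_eq_zero.1 (?_ : (4 : K) * _ = 0)).resolve_left h4
    rw [← hd, Finset.mul_sum]
    exact Finset.sum_congr rfl fun i _ => by ring
  have hsum {R : Type _} [CommRing R] (f : K →+* R) (x y z : R) :
      ∑ i, f (α i) * (x + f (h i) * y + f (k i) * z) ^ 4 = 0 := by
    rcases weights_eq_zero_or_affine hdist hα hαk with rfl | ⟨a, b, hab⟩
    · simp
    · exact sum_pow_four_eq_zero_of_affine f hα hab x y z
  refine ⟨?_, hsum C _ _ _⟩
  rw [hsum C] at heq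
  exact (mul_eq_zero.1 heq.symm).resolve_left (pow_ne_zero 2 (X_ne_zero 2))
end

section
/- Let K be a field of characteristic zero, n ≥ 1, and d, δ ≥ 0. For i = 1,…,n let ℓᵢ = uᵢ X₀ + vᵢ X₁ be linear forms in K[X₀,X₁] and let a₁,…,aₙ ∈ K satisfy Σᵢ₌₁ⁿ aᵢ ℓᵢ^{d+δ} = 0. Then for every homogeneous polynomial t(Y₀,Y₁) of degree δ in two variables, Σᵢ₌₁ⁿ aᵢ t(uᵢ,vᵢ) ℓᵢᵈ = 0 in K[X₀,X₁]. -/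
open MvPolynomial

namespace MvPolynomial

variable {K ι σ : Type*} [Field K] [Fintype ι] [Fintype σ]

/-- The linear form with coefficient vector `w`. -/
noncomputable def linearFormOfCoeffs (w : σ → K) : MvPolynomial σ K := ∑ j, C (w j) * X j

lemma pderiv_linearFormOfCoeffs (w : σ → K) (j : σ) :
    pderiv j (linearFormOfCoeffs w) = C (w j) := by
  classical
  simp [linearFormOfCoeffs, pderiv_X, Pi.single_apply]

variable [CharZero K]

/-- Differentiating a linear relation among powers of linear forms. -/
lemma sum_mul_coeff_linearFormOfCoeffs_pow_eq_zero (w : ι → σ → K) (j : σ) (d : ℕ) (a : ι → K)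
    (h : ∑ i, C (a i) * linearFormOfCoeffs (w i) ^ (d + 1) = 0) :
    ∑ i, C (a i * w i j) * linearFormOfCoeffs (w i) ^ d = 0 := by
  have hd : (C ((d : K) + 1) : MvPolynomial σ K) ≠ 0 := by
    rw [Ne, C_eq_zero]
    exact Nat.cast_add_one_ne_zero d
  refine (mul_eq_zero.mp ?_).resolve_left hd
  rw [← map_zero (pderiv (R := K) j), ← h, map_sum, Finset.mul_sum]
  refine Finset.sum_congr rfl fun i _ => ?_
  rw [pderiv_C_mul, pderiv_pow, pderiv_linearFormOfCoeffs]
  simp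
  ring

lemma sum_eval_monomial_mul_linearFormOfCoeffs_pow_eq_zero (w : ι → σ → K) (m : σ →₀ ℕ) :
    ∀ (d : ℕ) (a : ι → K),
      ∑ i, C (a i) * linearFormOfCoeffs (w i) ^ (d + m.degree) = 0 →
      ∑ i, C (a i * eval (w i) (monomial m 1)) * linearFormOfCoeffs (w i) ^ d = 0 := by
  induction m using Finsupp.induction_linear with
  | zero => intro d a h; simpa using h
  | add f g hf hg =>
    intro d a h
    rw [map_add, ← add_assoc, add_right_comm] at h
    have := hf d _ (hg (d + f.degree) a (by rwa [add_right_comm] at h))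
    rw [← this]
    refine Finset.sum_congr rfl fun i _ => ?_
    rw [← one_mul (1 : K), ← monomial_mul, map_mul (eval (w i)), one_mul, mul_assoc (a i),
      mul_comm (eval (w i) (monomial g 1))]
  | single j k =>
    induction k with
    | zero => intro d a h; simpa using h
    | succ k ih =>
      intro d a h
      rw [Finsupp.degree_single, ← add_assoc] at h
      have h' := sum_mul_coeff_linearFormOfCoeffs_pow_eq_zero w j (d + k) a h
      have := ih d _ (by rwa [Finsupp.degree_single])
      rw [← this]
      refine Finset.sum_congr rfl fun i _ => ?_
      congr 2
      rw [← X_pow_eq_monomial, ← X_pow_eq_monomial, map_pow, map_pow, eval_X]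
      ring

/-- Applying a homogeneous constant-coefficient differential operator to a linear relation among
powers of linear forms. -/
lemma IsHomogeneous.sum_eval_mul_linearFormOfCoeffs_pow_eq_zero {t : MvPolynomial σ K} {δ : ℕ}
    (ht : t.IsHomogeneous δ) (w : ι → σ → K) (d : ℕ) (a : ι → K)
    (h : ∑ i, C (a i) * linearFormOfCoeffs (w i) ^ (d + δ) = 0) :
    ∑ i, C (a i * eval (w i) t) * linearFormOfCoeffs (w i) ^ d = 0 := by
  have key (i : ι) : C (a i * eval (w i) t) * linearFormOfCoeffs (w i) ^ d =
      ∑ m ∈ t.support, C (coeff m t) *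
        (C (a i * eval (w i) (monomial m 1)) * linearFormOfCoeffs (w i) ^ d) := by
    simp_rw [← mul_assoc, ← MvPolynomial.C_mul, ← Finset.sum_mul, ← map_sum]
    congr 2
    rw [eval_eq, Finset.mul_sum]
    refine Finset.sum_congr rfl fun m _ => ?_
    simp [eval_monomial, Finsupp.prod]
    ring
  simp_rw [key]
  rw [Finset.sum_comm]
  refine Finset.sum_eq_zero fun m hm => ?_
  rw [← Finset.mul_sum, sum_eval_monomial_mul_linearFormOfCoeffs_pow_eq_zero, mul_zero]
  have hdeg : m.degree = δ := by
    rw [Finsupp.degree_eq_weight_one]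
    exact ht (mem_support_iff.mp hm)
  rwa [hdeg]

end MvPolynomial

/-- if `ℓᵢ = uᵢX₀ + vᵢX₁` and `∑ aᵢ ℓᵢ^{d+δ} = 0`, then for every
homogeneous polynomial `t` of degree `δ` in two variables,
`∑ aᵢ t(uᵢ,vᵢ) ℓᵢᵈ = 0`. -/
theorem stmt_8 (K : Type*) [Field K] [CharZero K]
    (n : ℕ) (hn : 1 ≤ n) (d δ : ℕ)
    (u v a : Fin n → K)
    (hsum : ∑ i, C (a i) *
        (C (u i) * X 0 + C (v i) * X 1 : MvPolynomial (Fin 2) K) ^ (d + δ) = 0)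
    (t : MvPolynomial (Fin 2) K) (ht : t.IsHomogeneous δ) :
    ∑ i, C (a i * eval ![u i, v i] t) *
        (C (u i) * X 0 + C (v i) * X 1 : MvPolynomial (Fin 2) K) ^ d = 0 := by
  have hℓ (i : Fin n) : (C (u i) * X 0 + C (v i) * X 1 : MvPolynomial (Fin 2) K) =
      linearFormOfCoeffs ![u i, v i] := by
    simp [linearFormOfCoeffs, Fin.sum_univ_two]
  simp_rw [hℓ] at hsum ⊢
  exact ht.sum_eval_mul_linearFormOfCoeffs_pow_eq_zero _ d a hsum
end

section
/- Let K be a field of characteristic zero and let L₁,…,L₇ be nonzero linear forms in K[X₀,X₁] that are pairwise non-proportional (no Lᵢ is a scalar multiple of Lⱼ for i ≠ j), with Lᵢ = uᵢ X₀ + vᵢ X₁. Suppose Σᵢ₌₁⁷ Lᵢ⁴ = 0. Then there exists w = (w₀,w₁) ∈ K² such that Lᵢ(w) = uᵢ w₀ + vᵢ w₁ ≠ 0 for every i, and Σᵢ₌₁⁷ (1 / Lᵢ(w)) Lᵢ⁵ = 0 in K[X₀,X₁]. -/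
open MvPolynomial

/-- The expansion of a scaled power of a binary linear form into monomials. -/
lemma C_mul_linearForm_pow {K : Type*} [Field K] (a u v : K) (n : ℕ) :
    C a * (C u * X 0 + C v * X 1 : MvPolynomial (Fin 2) K) ^ n =
      ∑ m ∈ Finset.range (n + 1),
        monomial (Finsupp.single 0 m + Finsupp.single 1 (n - m))
          ((n.choose m : K) * (a * u ^ m * v ^ (n - m))) := by
  rw [add_pow, Finset.mul_sum]
  refine Finset.sum_congr rfl fun m _ => ?_
  rw [monomial_eq, Finsupp.prod_add_index' (by simp) (by intros; rw [pow_add]),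
    Finsupp.prod_single_index (by simp), Finsupp.prod_single_index (by simp)]
  simp only [map_mul, map_pow, map_natCast]
  ring

/-- A linear relation between `n`-th powers of binary linear forms amounts to the vanishing of
all the moments of degree `n` of its coefficients. -/
lemma sum_C_mul_linearForm_pow_eq_zero_iff {K ι : Type*} [Field K] [CharZero K] (s : Finset ι)
    (a u v : ι → K) (n : ℕ) :
    ∑ i ∈ s, C (a i) * (C (u i) * X 0 + C (v i) * X 1 : MvPolynomial (Fin 2) K) ^ n = 0 ↔
      ∀ p q, p + q = n → ∑ i ∈ s, a i * u i ^ p * v i ^ q = 0 := by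
  have key : ∑ i ∈ s, C (a i) * (C (u i) * X 0 + C (v i) * X 1 : MvPolynomial (Fin 2) K) ^ n =
      ∑ m ∈ Finset.range (n + 1),
        monomial (Finsupp.single 0 m + Finsupp.single 1 (n - m))
          ((n.choose m : K) * ∑ i ∈ s, a i * u i ^ m * v i ^ (n - m)) := by
    simp only [C_mul_linearForm_pow, Finset.mul_sum, map_sum]
    exact Finset.sum_comm
  rw [key]
  constructor
  · rintro h p q rfl
    have h' := congrArg (coeff (Finsupp.single 0 p + Finsupp.single 1 q)) h
    rw [coeff_sum, Finset.sum_eq_single p] at h'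
    · rw [Nat.add_sub_cancel_left, coeff_monomial, if_pos rfl, coeff_zero] at h'
      refine (mul_eq_zero.mp h').resolve_left ?_
      exact_mod_cast (Nat.choose_pos (Nat.le_add_right p q)).ne'
    · intro m _ hm
      rw [coeff_monomial, if_neg]
      intro he
      exact hm (by simpa using DFunLike.congr_fun he 0)
    · intro hp
      exact absurd (Finset.mem_range.mpr (by omega)) hp
  · intro h
    refine Finset.sum_eq_zero fun m hm => ?_
    rw [h m (n - m) (by have := Finset.mem_range.mp hm; omega), mul_zero, map_zero]

/-- At most `n + 1` pairwise independent vectors of the plane have linearly independent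
images under the Veronese map of degree `n`. -/
lemma eq_zero_of_moments_eq_zero_s9 {K ι : Type*} [Field K] (u v : ι → K)
    (h0 : ∀ i, u i ≠ 0 ∨ v i ≠ 0) (hdet : ∀ i j, i ≠ j → u i * v j - v i * u j ≠ 0)
    (s : Finset ι) (n : ℕ) (hs : s.card ≤ n + 1) (a : ι → K)
    (h : ∀ p q, p + q = n → ∑ i ∈ s, a i * u i ^ p * v i ^ q = 0) :
    ∀ i ∈ s, a i = 0 := by
  classical
  induction s using Finset.induction_on generalizing n a with
  | empty => simp
  | insert j s hj ih =>
    have hzero : ∀ i ∈ s, a i = 0 := by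
      rw [Finset.card_insert_of_notMem hj] at hs
      rcases n with _ | n
      · have : s = ∅ := Finset.card_eq_zero.mp (by omega)
        simp [this]
      · intro i hi
        refine (mul_eq_zero.mp (ih n (by omega)
          (fun i => a i * (u i * v j - v i * u j)) ?_ i hi)).resolve_right
          (hdet i j (ne_of_mem_of_not_mem hi hj))
        intro p q hpq
        have h1 := h (p + 1) q (by omega)
        have h2 := h p (q + 1) (by omega)
        rw [Finset.sum_insert hj] at h1 h2
        have h3 : ∑ i ∈ s, a i * (u i * v j - v i * u j) * u i ^ p * v i ^ q =
            v j * ∑ i ∈ s, a i * u i ^ (p + 1) * v i ^ q -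
              u j * ∑ i ∈ s, a i * u i ^ p * v i ^ (q + 1) := by
          rw [Finset.mul_sum, Finset.mul_sum, ← Finset.sum_sub_distrib]
          exact Finset.sum_congr rfl fun i _ => by ring
        rw [h3]
        linear_combination v j * h1 - u j * h2
    have hsingle : ∀ p q, p + q = n → a j * u j ^ p * v j ^ q = 0 := by
      intro p q hpq
      have h1 := h p q hpq
      rwa [Finset.sum_insert hj,
        Finset.sum_eq_zero (s := s) fun i hi => by rw [hzero i hi]; ring, add_zero] at h1
    intro i hi
    rcases Finset.mem_insert.mp hi with rfl | hi
    · rcases h0 i with hu | hv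
      · simpa [hu] using hsingle n 0 (by omega)
      · simpa [hv] using hsingle 0 n (by omega)
    · exact hzero i hi

/-- Any `n + 2` points of the plane satisfy a nontrivial relation between their images under the
Veronese map of degree `n`. -/
lemma exists_moments_eq_zero {K : Type*} [Field K] (n : ℕ) (u v : Fin (n + 2) → K) :
    ∃ c : Fin (n + 2) → K, c ≠ 0 ∧
      ∀ p q, p + q = n → ∑ i, c i * u i ^ p * v i ^ q = 0 := by
  let M : Matrix (Fin (n + 1)) (Fin (n + 2)) K := fun p i => u i ^ (p : ℕ) * v i ^ (n - p)
  obtain ⟨c, hc, hne⟩ := Submodule.exists_mem_ne_zero_of_ne_bot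
    (LinearMap.ker_ne_bot_of_finrank_lt (f := M.mulVecLin) (by simp))
  refine ⟨c, hne, fun p q hpq => ?_⟩
  have h := congrFun (LinearMap.mem_ker.mp hc) ⟨p, by omega⟩
  obtain rfl : q = n - p := by omega
  rw [Matrix.mulVecLin_apply, Pi.zero_apply] at h
  rw [← h]
  exact Finset.sum_congr rfl fun i _ => by simp only [M]; ring

/-- Two independent linear forms on the plane take prescribed nonzero values simultaneously. -/
lemma exists_mul_linearForm_eq_one {K : Type*} [Field K] {a b a' b' c c' : K}
    (hD : a * b' - b * a' ≠ 0) (hc : c ≠ 0) (hc' : c' ≠ 0) :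
    ∃ x y : K, c * (a * x + b * y) = 1 ∧ c' * (a' * x + b' * y) = 1 := by
  have h := mul_inv_cancel₀ hc
  have h' := mul_inv_cancel₀ hc'
  have hD' := mul_inv_cancel₀ hD
  refine ⟨(b' * c⁻¹ - b * c'⁻¹) * (a * b' - b * a')⁻¹,
    (a * c'⁻¹ - a' * c⁻¹) * (a * b' - b * a')⁻¹, ?_, ?_⟩
  · linear_combination c * c⁻¹ * hD' + h
  · linear_combination c' * c'⁻¹ * hD' + h'

/-- if `L₁,…,L₇` (with `Lᵢ = uᵢX₀ + vᵢX₁`) are nonzero, pairwise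
non-proportional linear forms and `∑ Lᵢ⁴ = 0`, then there is `w = (w₀,w₁) ∈ K²` with
`Lᵢ(w) ≠ 0` for all `i` and `∑ (1 / Lᵢ(w)) Lᵢ⁵ = 0`. -/
theorem stmt_9 (K : Type*) [Field K] [CharZero K]
    (u v : Fin 7 → K)
    (hL0 : ∀ i, (C (u i) * X 0 + C (v i) * X 1 : MvPolynomial (Fin 2) K) ≠ 0)
    (hnp : ∀ i j : Fin 7, i ≠ j → ∀ c : K,
      (C (u i) * X 0 + C (v i) * X 1 : MvPolynomial (Fin 2) K) ≠
        C c * (C (u j) * X 0 + C (v j) * X 1))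
    (hsum : ∑ i, (C (u i) * X 0 + C (v i) * X 1 : MvPolynomial (Fin 2) K) ^ 4 = 0) :
    ∃ w0 w1 : K, (∀ i, u i * w0 + v i * w1 ≠ 0) ∧
      ∑ i, C (1 / (u i * w0 + v i * w1)) *
        (C (u i) * X 0 + C (v i) * X 1 : MvPolynomial (Fin 2) K) ^ 5 = 0 := by
  have h0 : ∀ i, u i ≠ 0 ∨ v i ≠ 0 := by
    intro i
    by_contra! h
    exact hL0 i (by simp [h.1, h.2])
  have hdet : ∀ i j, i ≠ j → u i * v j - v i * u j ≠ 0 := by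
    intro i j hij h
    rcases h0 j with hj | hj
    · have hv : v i = u i / u j * v j := by field_simp; linear_combination -h
      have hu : u i = u i / u j * u j := by field_simp
      refine hnp i j hij (u i / u j) ?_
      rw [mul_add, ← mul_assoc, ← mul_assoc, ← C_mul, ← C_mul, ← hv, ← hu]
    · have hv : v i = v i / v j * v j := by field_simp
      have hu : u i = v i / v j * u j := by field_simp; linear_combination h
      refine hnp i j hij (v i / v j) ?_
      rw [mul_add, ← mul_assoc, ← mul_assoc, ← C_mul, ← C_mul, ← hv, ← hu]
  have hsum' : ∀ p q, p + q = 4 → ∑ i, u i ^ p * v i ^ q = 0 := by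
    simpa using (sum_C_mul_linearForm_pow_eq_zero_iff Finset.univ (fun _ => 1) u v 4).mp
      (by simpa using hsum)
  obtain ⟨c, hc, hrel⟩ := exists_moments_eq_zero 5 u v
  have hc0 : ∀ k, c k ≠ 0 := by
    intro k hk
    refine hc (funext fun i => ?_)
    by_cases hik : i = k
    · rw [hik, hk, Pi.zero_apply]
    · refine eq_zero_of_moments_eq_zero_s9 u v h0 hdet (Finset.univ.erase k) 5 (by simp) c ?_ i
        (by simp [hik])
      intro p q hpq
      rw [Finset.sum_erase _ (by rw [hk]; ring)]
      exact hrel p q hpq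
  -- `w` is chosen so that `c i * Lᵢ(w) = 1` for `i = 0, 1`
  have hD : u 0 * v 1 - v 0 * u 1 ≠ 0 := hdet 0 1 (by decide)
  obtain ⟨w0, w1, e0, e1⟩ : ∃ w0 w1 : K,
      c 0 * (u 0 * w0 + v 0 * w1) = 1 ∧ c 1 * (u 1 * w0 + v 1 * w1) = 1 :=
    exists_mul_linearForm_eq_one hD (hc0 0) (hc0 1)
  have hone : ∀ i, c i * (u i * w0 + v i * w1) = 1 := by
    intro i
    by_cases hi0 : i = 0
    · rwa [hi0]
    by_cases hi1 : i = 1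
    · rwa [hi1]
    refine sub_eq_zero.mp (eq_zero_of_moments_eq_zero_s9 u v h0 hdet
      ((Finset.univ.erase 0).erase 1) 4 (by simp)
      (fun i => c i * (u i * w0 + v i * w1) - 1) ?_ i (by simp [hi0, hi1]))
    intro p q hpq
    rw [Finset.sum_erase _ (by rw [e1]; ring), Finset.sum_erase _ (by rw [e0]; ring)]
    have h1 := hrel (p + 1) q (by omega)
    have h2 := hrel p (q + 1) (by omega)
    have h3 := hsum' p q hpq
    calc ∑ i, (c i * (u i * w0 + v i * w1) - 1) * u i ^ p * v i ^ q
        = w0 * ∑ i, c i * u i ^ (p + 1) * v i ^ q + w1 * ∑ i, c i * u i ^ p * v i ^ (q + 1)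
            - ∑ i, u i ^ p * v i ^ q := by
          rw [Finset.mul_sum, Finset.mul_sum, ← Finset.sum_add_distrib,
            ← Finset.sum_sub_distrib]
          exact Finset.sum_congr rfl fun i _ => by ring
      _ = 0 := by rw [h1, h2, h3]; ring
  refine ⟨w0, w1, fun i => right_ne_zero_of_mul_eq_one (hone i), ?_⟩
  have hinv : ∀ i, 1 / (u i * w0 + v i * w1) = c i := fun i =>
    (eq_one_div_of_mul_eq_one_left (hone i)).symm
  simp only [hinv]
  exact (sum_C_mul_linearForm_pow_eq_zero_iff Finset.univ c u v 5).mpr hrel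
end

section
/- Let K be a field of characteristic zero and let L₁,…,L₇ be nonzero linear forms in K[X₀,X₁] that are pairwise non-proportional (no Lᵢ is a scalar multiple of Lⱼ for i ≠ j), with Lᵢ = uᵢ X₀ + vᵢ X₁. Let a = (a₁,…,a₇) ∈ K⁷ have all entries nonzero and satisfy Σᵢ₌₁⁷ aᵢ Lᵢ⁵ = 0. Then for every c = (c₁,…,c₇) ∈ K⁷ with Σᵢ₌₁⁷ cᵢ Lᵢ³ = 0, there exists a homogeneous polynomial b(Y₀,Y₁) of degree 2 such that cᵢ = aᵢ b(uᵢ,vᵢ) for all i = 1,…,7. -/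
open MvPolynomial

/-- Comparing coefficients in a relation between `n`-th powers of binary linear forms. -/
theorem sum_mul_pow_eq_zero_of_sum_linearForm_pow {K ι : Type*} [Field K] [CharZero K] [Fintype ι]
    {u v a : ι → K} {n : ℕ}
    (h : ∑ i, C (a i) * (C (u i) * X 0 + C (v i) * X 1 : MvPolynomial (Fin 2) K) ^ n = 0)
    {k l : ℕ} (hkl : k + l = n) : ∑ i, a i * (u i ^ k * v i ^ l) = 0 := by
  have h1 := congrArg (fun p => Polynomial.coeff
    (aeval (![Polynomial.X, 1] : Fin 2 → Polynomial K) p) k) h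
  simp only [map_sum, map_mul, map_pow, map_add, aeval_X, algHom_C, Polynomial.finsetSum_coeff,
    Matrix.cons_val_zero, Matrix.cons_val_one, mul_one, map_zero, Polynomial.coeff_zero,
    Polynomial.algebraMap_eq, Polynomial.coeff_C_mul] at h1
  have h2 (x y : K) : ((Polynomial.C x * Polynomial.X + Polynomial.C y) ^ n).coeff k =
      (n.choose k : K) * (x ^ k * y ^ l) := by
    have hl : n - k = l := by omega
    have hk : k < n + 1 := by omega
    rw [add_pow, Polynomial.finsetSum_coeff, Finset.sum_eq_single k]
    · rw [mul_pow, ← Polynomial.C_pow, ← Polynomial.C_pow, hl, ← Polynomial.C_eq_natCast,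
        Polynomial.coeff_mul_C, Polynomial.coeff_mul_C, Polynomial.coeff_C_mul,
        Polynomial.coeff_X_pow_self]
      ring
    · intro m _ hm
      rw [mul_pow, ← Polynomial.C_pow, ← Polynomial.C_pow, ← Polynomial.C_eq_natCast,
        Polynomial.coeff_mul_C, Polynomial.coeff_mul_C, Polynomial.coeff_C_mul,
        Polynomial.coeff_X_pow, if_neg hm.symm]
      ring
    · intro hk'
      exact absurd (Finset.mem_range.mpr hk) hk'
  simp only [h2, mul_left_comm (a _) (n.choose k : K), ← Finset.mul_sum] at h1
  refine (mul_eq_zero.mp h1).resolve_left ?_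
  exact_mod_cast (Nat.choose_pos (by omega)).ne'

/-- Apolarity: a relation between `n`-th powers of linear forms annihilates the values at the
coefficient pairs of every form of degree `n`. -/
theorem sum_mul_eval_eq_zero_of_sum_linearForm_pow {K ι : Type*} [Field K] [CharZero K] [Fintype ι]
    {u v a : ι → K} {n : ℕ}
    (h : ∑ i, C (a i) * (C (u i) * X 0 + C (v i) * X 1 : MvPolynomial (Fin 2) K) ^ n = 0)
    {f : MvPolynomial (Fin 2) K} (hf : f.IsHomogeneous n) :
    ∑ i, a i * eval ![u i, v i] f = 0 := by
  simp only [eval_eq', Finset.mul_sum, Fin.prod_univ_two, Matrix.cons_val_zero,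
    Matrix.cons_val_one, mul_left_comm (a _) (coeff _ f)]
  rw [Finset.sum_comm]
  refine Finset.sum_eq_zero fun m hm => ?_
  have hdeg := hf (mem_support_iff.mp hm)
  rw [← Finset.mul_sum, sum_mul_pow_eq_zero_of_sum_linearForm_pow h, mul_zero]
  simpa [Finsupp.weight_apply, Finsupp.sum_fintype] using hdeg

/-- Homogeneous Lagrange interpolation at pairwise non-proportional points of the plane. -/
theorem exists_isHomogeneous_eval_eq {K ι : Type*} [Field K] [DecidableEq ι] {u v : ι → K}
    (S : Finset ι) (hS : ∀ i ∈ S, ∀ j ∈ S, i ≠ j → u i * v j - v i * u j ≠ 0) (w : ι → K) :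
    ∃ b : MvPolynomial (Fin 2) K, b.IsHomogeneous (S.card - 1) ∧
      ∀ i ∈ S, eval ![u i, v i] b = w i := by
  refine ⟨∑ i ∈ S, C (w i * (∏ j ∈ S.erase i, (u i * v j - v i * u j))⁻¹) *
    ∏ j ∈ S.erase i, (C (v j) * X 0 - C (u j) * X 1), ?_, ?_⟩
  · refine IsHomogeneous.sum _ _ _ fun i hi => ?_
    have hprod := IsHomogeneous.prod (S.erase i)
      (fun j => (C (v j) * X 0 - C (u j) * X 1 : MvPolynomial (Fin 2) K)) (fun _ => 1)
      fun j _ => (isHomogeneous_C_mul_X _ _).sub (isHomogeneous_C_mul_X _ _)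
    rw [Finset.sum_const, smul_eq_mul, mul_one, Finset.card_erase_of_mem hi] at hprod
    exact hprod.C_mul _
  · intro i hi
    rw [map_sum, Finset.sum_eq_single_of_mem i hi]
    · have hne : ∏ j ∈ S.erase i, (u i * v j - v i * u j) ≠ 0 :=
        Finset.prod_ne_zero_iff.mpr fun j hj =>
          hS i hi j (Finset.mem_of_mem_erase hj) (Finset.ne_of_mem_erase hj).symm
      have heval : eval ![u i, v i]
          (∏ j ∈ S.erase i, (C (v j) * X 0 - C (u j) * X 1 : MvPolynomial (Fin 2) K)) =
          ∏ j ∈ S.erase i, (u i * v j - v i * u j) := by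
        rw [map_prod]
        refine Finset.prod_congr rfl fun j _ => ?_
        simp [mul_comm]
      rw [map_mul, eval_C, heval, mul_assoc, inv_mul_cancel₀ hne, mul_one]
    · intro k _ hk
      rw [map_mul, map_prod]
      refine mul_eq_zero_of_right _ (Finset.prod_eq_zero (Finset.mem_erase.mpr ⟨hk.symm, hi⟩) ?_)
      simp [mul_comm]

/-- Non-proportional binary linear forms have nonzero coefficient determinant. -/
theorem det_ne_zero_of_forall_linearForm_ne {K : Type*} [Field K] {p q r s : K}
    (h0 : (C r * X 0 + C s * X 1 : MvPolynomial (Fin 2) K) ≠ 0)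
    (h : ∀ γ : K, (C p * X 0 + C q * X 1 : MvPolynomial (Fin 2) K) ≠
      C γ * (C r * X 0 + C s * X 1)) :
    p * s - q * r ≠ 0 := by
  intro hd
  have key (γ : K) (hp : p = γ * r) (hq : q = γ * s) : False := by
    refine h γ ?_
    rw [hp, hq, C_mul, C_mul]
    ring
  by_cases hr : r = 0
  · have hs : s ≠ 0 := by
      rintro rfl
      simp [hr] at h0
    have hp : p = 0 := by simpa [hr, hs] using hd
    exact key (q / s) (by simp [hp, hr]) (by field_simp)
  · refine key (p / r) (by field_simp) ?_
    field_simp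
    linear_combination -hd


/-- let `L₁,…,L₇` (with `Lᵢ = uᵢX₀ + vᵢX₁`) be nonzero pairwise
non-proportional linear forms, and `a ∈ K⁷` with all entries nonzero and
`∑ aᵢ Lᵢ⁵ = 0`. Then every `c ∈ K⁷` with `∑ cᵢ Lᵢ³ = 0` is of the form
`cᵢ = aᵢ b(uᵢ,vᵢ)` for a single homogeneous polynomial `b` of degree 2. -/
theorem stmt_11 (K : Type*) [Field K] [CharZero K]
    (u v : Fin 7 → K)
    (hL0 : ∀ i, (C (u i) * X 0 + C (v i) * X 1 : MvPolynomial (Fin 2) K) ≠ 0)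
    (hnp : ∀ i j : Fin 7, i ≠ j → ∀ γ : K,
      (C (u i) * X 0 + C (v i) * X 1 : MvPolynomial (Fin 2) K) ≠
        C γ * (C (u j) * X 0 + C (v j) * X 1))
    (a : Fin 7 → K) (ha : ∀ i, a i ≠ 0)
    (hsum : ∑ i, C (a i) *
        (C (u i) * X 0 + C (v i) * X 1 : MvPolynomial (Fin 2) K) ^ 5 = 0)
    (c : Fin 7 → K)
    (hc : ∑ i, C (c i) *
        (C (u i) * X 0 + C (v i) * X 1 : MvPolynomial (Fin 2) K) ^ 3 = 0) :
    ∃ b : MvPolynomial (Fin 2) K, b.IsHomogeneous 2 ∧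
      ∀ i, c i = a i * eval ![u i, v i] b := by
  have hdet : ∀ i j : Fin 7, i ≠ j → u i * v j - v i * u j ≠ 0 := fun i j hij =>
    det_ne_zero_of_forall_linearForm_ne (hL0 j) (hnp i j hij)
  obtain ⟨b, hb, hbS⟩ := exists_isHomogeneous_eval_eq ({0, 1, 2} : Finset (Fin 7))
    (fun i _ j _ => hdet i j) fun i => c i / a i
  have hb2 : b.IsHomogeneous 2 := hb
  have hS : ∀ i ∈ ({0, 1, 2} : Finset (Fin 7)), c i - a i * eval ![u i, v i] b = 0 := by
    intro i hi
    rw [hbS i hi, mul_div_cancel₀ _ (ha i), sub_self]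
  refine ⟨b, hb2, fun i => sub_eq_zero.mp ?_⟩
  by_cases hi : i ∈ ({0, 1, 2} : Finset (Fin 7))
  · exact hS i hi
  obtain ⟨q, hq, hqT⟩ := exists_isHomogeneous_eval_eq ({0, 1, 2}ᶜ : Finset (Fin 7))
    (fun i _ j _ => hdet i j) (Pi.single i 1)
  have hq3 : q.IsHomogeneous 3 := hq
  have hcq := sum_mul_eval_eq_zero_of_sum_linearForm_pow hc hq3
  have habq := sum_mul_eval_eq_zero_of_sum_linearForm_pow hsum (hb2.mul hq3)
  have hsub : ∑ k, (c k - a k * eval ![u k, v k] b) * eval ![u k, v k] q = 0 := by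
    simp only [map_mul, ← mul_assoc] at habq
    simp only [sub_mul, Finset.sum_sub_distrib, hcq, habq, sub_zero]
  rw [Finset.sum_eq_single i] at hsub
  · simpa [hqT i (Finset.mem_compl.mpr hi)] using hsub
  · intro k _ hk
    by_cases hkS : k ∈ ({0, 1, 2} : Finset (Fin 7))
    · rw [hS k hkS, zero_mul]
    · rw [hqT k (Finset.mem_compl.mpr hkS), Pi.single_eq_of_ne hk, mul_zero]
  · simp
end

section
/- Let K be a field of characteristic p ≥ 5 (so p ∉ {2,3}) and V a K-vector space of dimension 3. Let x ∈ V* be a nonzero linear form and q a nonzero quadratic form on V. Suppose x²q = l₁⁴ + ⋯ + l₇⁴ for linear forms l₁,…,l₇ ∈ V* such that the seven lines lᵢ = 0 in P(V) intersect the line x = 0 in seven distinct points (no lᵢ is a scalar multiple of x, and for i ≠ j the subspaces ker lᵢ ∩ ker x and ker lⱼ ∩ ker x are distinct one-dimensional subspaces). Then there exists a nonzero vector w ∈ ker x such that the polar bilinear form of q, namely B(w,u) = q(w+u) − q(w) − q(u), vanishes for every u ∈ ker x; that is, the line x = 0 is (possibly improperly) tangent to the conic q = 0. -/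
open MvPolynomial

section Forms

variable {σ K : Type*} [Field K]

lemma MvPolynomial.IsHomogeneous.exists_linearMap [Fintype σ] {l : MvPolynomial σ K}
    (hl : l.IsHomogeneous 1) :
    ∃ f : (σ → K) →ₗ[K] K, (∀ v, eval v l = f v) ∧
      ∀ (x : MvPolynomial σ K) (φ : (σ → K) →ₗ[K] K) (c : K), x.IsHomogeneous 1 →
        (∀ v, eval v x = φ v) → f = c • φ → l = C c * x := by
  classical
  have key : ∀ p : MvPolynomial σ K, p.IsHomogeneous 1 →
      ∃ k : σ → K, p = ∑ j, C (k j) * X j := by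
    intro p hp
    rw [← mem_homogeneousSubmodule, homogeneousSubmodule_one_eq_span_X,
      Submodule.mem_span_range_iff_exists_fun] at hp
    obtain ⟨k, rfl⟩ := hp
    exact ⟨k, by simp [smul_eq_C_mul]⟩
  obtain ⟨k, hk⟩ := key l hl
  refine ⟨∑ j, k j • LinearMap.proj j, fun v => by simp [hk], ?_⟩
  intro x φ c hx hφ hf
  obtain ⟨m, hm⟩ := key x hx
  have hkm : ∀ j, k j = c * m j := by
    intro j
    have h1 := LinearMap.congr_fun hf (Pi.single j 1)
    have h2 := hφ (Pi.single j 1)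
    simp [hm, Pi.single_apply] at h1 h2
    rw [h1, h2]
  rw [hk, hm, Finset.mul_sum]
  exact Finset.sum_congr rfl fun j _ => by rw [hkm, map_mul, mul_assoc]

lemma MvPolynomial.IsHomogeneous.exists_quadraticForm [Fintype σ] {q : MvPolynomial σ K}
    (hq : q.IsHomogeneous 2) : ∃ Q : QuadraticForm K (σ → K), ∀ v, eval v q = Q v := by
  rw [← mem_homogeneousSubmodule, ← homogeneousSubmodule_one_pow, pow_two] at hq
  induction hq using Submodule.mul_induction_on' with
  | mem_mul_mem m hm n hn =>
    obtain ⟨f, hf, -⟩ := IsHomogeneous.exists_linearMap ((mem_homogeneousSubmodule _ _).1 hm)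
    obtain ⟨g, hg, -⟩ := IsHomogeneous.exists_linearMap ((mem_homogeneousSubmodule _ _).1 hn)
    exact ⟨QuadraticMap.linMulLin f g, fun v => by simp [hf, hg]⟩
  | add x _ y _ hx hy =>
    obtain ⟨Q, hQ⟩ := hx
    obtain ⟨R, hR⟩ := hy
    exact ⟨Q + R, fun v => by simp [hQ, hR]⟩

end Forms

section PowerSums

variable {K : Type*} [Field K]

/-- A binary quadratic form with three pairwise non-proportional zeros vanishes identically. -/
lemma binary_quadratic_eq_zero {r s t : K} {a b : Fin 3 → K}
    (hne : ∀ i j, i ≠ j → a i * b j - a j * b i ≠ 0)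
    (h : ∀ i, r * a i ^ 2 + s * (a i * b i) + t * b i ^ 2 = 0) : r = 0 ∧ s = 0 ∧ t = 0 := by
  have h01 := hne 0 1 (by decide)
  have h02 := hne 0 2 (by decide)
  have h12 := hne 1 2 (by decide)
  have e0 := h 0
  have e1 := h 1
  have e2 := h 2
  have hD := mul_ne_zero (mul_ne_zero h01 h02) h12
  refine ⟨?_, ?_, ?_⟩ <;> refine (mul_eq_zero.1 ?_).resolve_left hD
  · linear_combination (a 1 * b 1 * b 2 ^ 2 - a 2 * b 2 * b 1 ^ 2) * e0 -
      (a 0 * b 0 * b 2 ^ 2 - a 2 * b 2 * b 0 ^ 2) * e1 +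
      (a 0 * b 0 * b 1 ^ 2 - a 1 * b 1 * b 0 ^ 2) * e2
  · linear_combination -(a 1 ^ 2 * b 2 ^ 2 - a 2 ^ 2 * b 1 ^ 2) * e0 +
      (a 0 ^ 2 * b 2 ^ 2 - a 2 ^ 2 * b 0 ^ 2) * e1 -
      (a 0 ^ 2 * b 1 ^ 2 - a 1 ^ 2 * b 0 ^ 2) * e2
  · linear_combination (a 1 ^ 2 * (a 2 * b 2) - a 2 ^ 2 * (a 1 * b 1)) * e0 -
      (a 0 ^ 2 * (a 2 * b 2) - a 2 ^ 2 * (a 0 * b 0)) * e1 +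
      (a 0 ^ 2 * (a 1 * b 1) - a 1 ^ 2 * (a 0 * b 0)) * e2

/-- If all quartic moments of seven points `(a i, b i)` vanish, and all cubic moments weighted by
`c` vanish, then `c` is a quotient of a binary quadratic form by a nonzero binary linear form. -/
lemma exists_linear_quadratic_of_moments {a b c : Fin 7 → K}
    (hne : ∀ i j, i ≠ j → a i * b j - a j * b i ≠ 0)
    (h4 : ∀ k : Fin 5, ∑ i, a i ^ (k : ℕ) * b i ^ (4 - k : ℕ) = 0)
    (h3 : ∀ k : Fin 4, ∑ i, c i * (a i ^ (k : ℕ) * b i ^ (3 - k : ℕ)) = 0) :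
    ∃ y z r s t : K, (y ≠ 0 ∨ z ≠ 0) ∧
      ∀ i, c i * (y * a i + z * b i) = r * a i ^ 2 + s * (a i * b i) + t * b i ^ 2 := by
  have hquad : ∀ r s t : K, (∀ i, r * a i ^ 2 + s * (a i * b i) + t * b i ^ 2 = 0) →
      r = 0 ∧ s = 0 ∧ t = 0 := fun r s t h =>
    binary_quadratic_eq_zero (a := fun i : Fin 3 => a (i.castLE (by decide)))
      (b := fun i : Fin 3 => b (i.castLE (by decide)))
      (fun i j hij => hne _ _ (by simpa using hij)) (fun i => h _)
  let E : Matrix (Fin 7) (Fin 3) K := .of fun i => ![a i ^ 2, a i * b i, b i ^ 2]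
  let T : Matrix (Fin 7) (Fin 5) K :=
    .of fun i => ![c i * a i, c i * b i, -a i ^ 2, -(a i * b i), -b i ^ 2]
  have hE : E.rank = 3 := by
    rw [← Matrix.rank_transpose]
    have hli : LinearIndependent K E.col := by
      rw [← Matrix.mulVec_injective_iff, ← Matrix.coe_mulVecLin, ← LinearMap.ker_eq_bot,
        LinearMap.ker_eq_bot']
      intro v hv
      obtain ⟨h0, h1, h2⟩ := hquad (v 0) (v 1) (v 2) fun i => by
        have := congrFun hv i
        simp [E, Matrix.mulVec, dotProduct, Fin.sum_univ_three] at this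
        linear_combination this
      ext j
      fin_cases j <;> simpa
    simpa using LinearIndependent.rank_matrix (M := E.transpose) hli
  have h40 := h4 0
  have h41 := h4 1
  have h42 := h4 2
  have h43 := h4 3
  have h44 := h4 4
  have h30 := h3 0
  have h31 := h3 1
  have h32 := h3 2
  have h33 := h3 3
  simp [Fin.sum_univ_seven] at h40 h41 h42 h43 h44 h30 h31 h32 h33
  have hET : E.transpose * T = 0 := by
    ext i j
    fin_cases i <;> fin_cases j <;>
      simp [E, T, Matrix.mul_apply, Fin.sum_univ_seven]
    · linear_combination h33
    · linear_combination h32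
    · linear_combination -h44
    · linear_combination -h43
    · linear_combination -h42
    · linear_combination h32
    · linear_combination h31
    · linear_combination -h43
    · linear_combination -h42
    · linear_combination -h41
    · linear_combination h31
    · linear_combination h30
    · linear_combination -h42
    · linear_combination -h41
    · linear_combination -h40
  have hT := Matrix.rank_add_rank_le_card_of_mul_eq_zero hET
  rw [Matrix.rank_transpose, hE, Fintype.card_fin] at hT
  have hker : LinearMap.ker T.mulVecLin ≠ ⊥ := by
    intro hbot
    have h1 := T.mulVecLin.finrank_range_add_finrank_ker
    rw [hbot, finrank_bot, Module.finrank_fin_fun] at h1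
    have h2 : T.rank = 5 := h1
    omega
  obtain ⟨v, hv, hv0⟩ := Submodule.exists_mem_ne_zero_of_ne_bot hker
  have hv' : ∀ i, c i * (v 0 * a i + v 1 * b i) =
      v 2 * a i ^ 2 + v 3 * (a i * b i) + v 4 * b i ^ 2 := fun i => by
    have := congrFun (LinearMap.mem_ker.1 hv) i
    simp [T, Matrix.mulVec, dotProduct, Fin.sum_univ_five] at this
    linear_combination this
  refine ⟨v 0, v 1, v 2, v 3, v 4, ?_, hv'⟩
  by_contra! h01
  obtain ⟨h2, h3, h4⟩ := hquad (v 2) (v 3) (v 4) fun i => by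
    rw [← hv' i, h01.1, h01.2]; ring
  apply hv0
  ext j
  fin_cases j
  exacts [h01.1, h01.2, h2, h3, h4]

/-- The first coefficients, as polynomials in `s`, of
`(s φ₀)² Q(s e + u) = ∑ i, (s f i e + f i u) ^ 4`. -/
lemma power_sum_coefficients {V ι : Type*} [AddCommGroup V] [Module K V] [Fintype ι]
    (h2 : (2 : K) ≠ 0) (h3 : (3 : K) ≠ 0) {φ : V →ₗ[K] K} {Q : QuadraticForm K V}
    {f : ι → V →ₗ[K] K} (h : ∀ v, φ v ^ 2 * Q v = ∑ i, f i v ^ 4)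
    {e u : V} (he : φ e = 1) (hu : φ u = 0) :
    ∑ i, f i u ^ 4 = 0 ∧ ∑ i, f i e * f i u ^ 3 = 0 ∧
      Q u = 6 * ∑ i, f i e ^ 2 * f i u ^ 2 := by
  have hexp : ∀ s : K, s ^ 2 * (s ^ 2 * Q e + s * QuadraticMap.polar Q e u + Q u) =
      s ^ 4 * ∑ i, f i e ^ 4 + 4 * s ^ 3 * ∑ i, f i e ^ 3 * f i u +
      6 * s ^ 2 * ∑ i, f i e ^ 2 * f i u ^ 2 + 4 * s * ∑ i, f i e * f i u ^ 3 +
      ∑ i, f i u ^ 4 := by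
    intro s
    have h1 := h (s • e + u)
    rw [QuadraticMap.map_add (⇑Q), QuadraticMap.map_smul, QuadraticMap.polar_smul_left] at h1
    simp only [map_add, map_smul, he, hu, smul_eq_mul] at h1
    simp only [Finset.mul_sum, ← Finset.sum_add_distrib]
    calc _ = _ := by ring
      _ = _ := h1
      _ = _ := Finset.sum_congr rfl fun i _ => by ring
  have e0 := hexp 0
  have e1 := hexp 1
  have e2 := hexp (-1)
  have e3 := hexp 2
  have e4 := hexp (-2)
  have h4 : ∑ i, f i u ^ 4 = 0 := by linear_combination -e0
  have h48 : (48 : K) ≠ 0 := by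
    rw [show (48 : K) = 2 ^ 4 * 3 by norm_num]
    exact mul_ne_zero (pow_ne_zero _ h2) h3
  have h24 : (24 : K) ≠ 0 := by
    rw [show (24 : K) = 2 ^ 3 * 3 by norm_num]
    exact mul_ne_zero (pow_ne_zero _ h2) h3
  refine ⟨h4, (mul_eq_zero.1 ?_).resolve_left h48, ?_⟩
  · linear_combination e3 - e4 - 8 * e1 + 8 * e2
  · refine sub_eq_zero.1 ((mul_eq_zero.1 ?_).resolve_left h24)
    linear_combination 16 * e1 + 16 * e2 - e3 - e4 + 30 * h4

end PowerSums

section Tangency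

variable {K V : Type*} [Field K] [AddCommGroup V] [Module K V]

/-- Coordinate-free form of the tangency statement, with the distinctness of the seven points
expressed by non-proportionality on vectors `e₁, e₂` in the kernel of `φ`. -/
lemma exists_polar_eq_zero_of_basis (h2 : (2 : K) ≠ 0) (h3 : (3 : K) ≠ 0)
    {φ : V →ₗ[K] K} {Q : QuadraticForm K V} {f : Fin 7 → V →ₗ[K] K}
    (h : ∀ v, φ v ^ 2 * Q v = ∑ i, f i v ^ 4) {e e₁ e₂ : V} (he : φ e = 1)
    (he₁ : φ e₁ = 0) (he₂ : φ e₂ = 0)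
    (hne : ∀ i j, i ≠ j → f i e₁ * f j e₂ - f j e₁ * f i e₂ ≠ 0) :
    ∃ y z : K, (y ≠ 0 ∨ z ≠ 0) ∧ ∀ y' z' : K,
      Q ((y • e₁ + z • e₂) + (y' • e₁ + z' • e₂)) - Q (y • e₁ + z • e₂) -
        Q (y' • e₁ + z' • e₂) = 0 := by
  have hker : ∀ y z : K, φ (y • e₁ + z • e₂) = 0 := by simp [he₁, he₂]
  have key := fun y z : K => power_sum_coefficients h2 h3 h he (hker y z)
  have hquartic : ∀ y z : K, y ^ 4 * ∑ i, f i e₁ ^ 4 + 4 * y ^ 3 * z * ∑ i, f i e₁ ^ 3 * f i e₂ +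
      6 * y ^ 2 * z ^ 2 * ∑ i, f i e₁ ^ 2 * f i e₂ ^ 2 +
      4 * y * z ^ 3 * ∑ i, f i e₁ * f i e₂ ^ 3 + z ^ 4 * ∑ i, f i e₂ ^ 4 = 0 := by
    intro y z
    rw [← (key y z).1]
    simp only [Finset.mul_sum, ← Finset.sum_add_distrib, map_add, map_smul, smul_eq_mul]
    exact Finset.sum_congr rfl fun i _ => by ring
  have hcubic : ∀ y z : K, y ^ 3 * ∑ i, f i e * f i e₁ ^ 3 +
      3 * y ^ 2 * z * ∑ i, f i e * (f i e₁ ^ 2 * f i e₂) +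
      3 * y * z ^ 2 * ∑ i, f i e * (f i e₁ * f i e₂ ^ 2) + z ^ 3 * ∑ i, f i e * f i e₂ ^ 3 = 0 := by
    intro y z
    rw [← (key y z).2.1]
    simp only [Finset.mul_sum, ← Finset.sum_add_distrib, map_add, map_smul, smul_eq_mul]
    exact Finset.sum_congr rfl fun i _ => by ring
  have h6 : (6 : K) ≠ 0 := by
    rw [show (6 : K) = 2 * 3 by norm_num]
    exact mul_ne_zero h2 h3
  have h12 : (12 : K) ≠ 0 := by
    rw [show (12 : K) = 2 * 6 by norm_num]
    exact mul_ne_zero h2 h6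
  have h48 : (48 : K) ≠ 0 := by
    rw [show (48 : K) = 2 ^ 2 * 12 by norm_num]
    exact mul_ne_zero (pow_ne_zero _ h2) h12
  have q10 := hquartic 1 0
  have q01 := hquartic 0 1
  have q11 := hquartic 1 1
  have q12 := hquartic 1 (-1)
  have q13 := hquartic 1 2
  have q14 := hquartic 1 (-2)
  have q22 : ∑ i, f i e₁ ^ 2 * f i e₂ ^ 2 = 0 := (mul_eq_zero.1 (by
    linear_combination q11 + q12 - 2 * q10 - 2 * q01)).resolve_left h12
  have q1 : ∑ i, f i e₁ * f i e₂ ^ 3 = 0 := (mul_eq_zero.1 (by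
    linear_combination q13 - q14 - 2 * q11 + 2 * q12)).resolve_left h48
  have q3 : ∑ i, f i e₁ ^ 3 * f i e₂ = 0 := (mul_eq_zero.1 (by
    linear_combination 8 * q11 - 8 * q12 - q13 + q14)).resolve_left h48
  have c10 := hcubic 1 0
  have c01 := hcubic 0 1
  have c11 := hcubic 1 1
  have c12 := hcubic 1 (-1)
  have c2 : ∑ i, f i e * (f i e₁ ^ 2 * f i e₂) = 0 := (mul_eq_zero.1 (by
    linear_combination c11 - c12 - 2 * c01)).resolve_left h6
  have c1 : ∑ i, f i e * (f i e₁ * f i e₂ ^ 2) = 0 := (mul_eq_zero.1 (by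
    linear_combination c11 + c12 - 2 * c10)).resolve_left h6
  have c3 : ∑ i, f i e * f i e₁ ^ 3 = 0 := by linear_combination c10
  have c0 : ∑ i, f i e * f i e₂ ^ 3 = 0 := by linear_combination c01
  obtain ⟨y, z, r, s, t, hyz, hL⟩ := exists_linear_quadratic_of_moments
    (a := fun i => f i e₁) (b := fun i => f i e₂) (c := fun i => f i e) hne
    (fun k => by
      fin_cases k
      · simpa using (by linear_combination q01 : ∑ i, f i e₂ ^ 4 = 0)
      · simpa using q1
      · simpa using q22
      · simpa using q3
      · simpa using (by linear_combination q10 : ∑ i, f i e₁ ^ 4 = 0))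
    (fun k => by
      fin_cases k
      · simpa using c0
      · simpa using c1
      · simpa using c2
      · simpa using c3)
  refine ⟨y, z, hyz, fun y' z' => ?_⟩
  have hsum : y • e₁ + z • e₂ + (y' • e₁ + z' • e₂) = (y + y') • e₁ + (z + z') • e₂ := by module
  rw [hsum, (key _ _).2.2, (key y z).2.2, (key y' z').2.2]
  calc _ = 12 * ∑ i, f i e * (f i e * (y * f i e₁ + z * f i e₂)) *
        (y' * f i e₁ + z' * f i e₂) := by
        simp only [Finset.mul_sum, ← Finset.sum_sub_distrib, map_add, map_smul, smul_eq_mul]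
        exact Finset.sum_congr rfl fun i _ => by ring
    _ = 12 * (r * y' * ∑ i, f i e * f i e₁ ^ 3 +
        (r * z' + s * y') * ∑ i, f i e * (f i e₁ ^ 2 * f i e₂) +
        (s * z' + t * y') * ∑ i, f i e * (f i e₁ * f i e₂ ^ 2) +
        t * z' * ∑ i, f i e * f i e₂ ^ 3) := by
        simp only [hL, Finset.mul_sum, ← Finset.sum_add_distrib]
        exact Finset.sum_congr rfl fun i _ => by ring
    _ = 0 := by rw [c0, c1, c2, c3]; ring

end Tangency


open MvPolynomial

/-- the same tangency conclusion as in characteristic zero holds over a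
field of characteristic `p ≥ 5`: if `x² q = l₁⁴ + ⋯ + l₇⁴` with the seven lines
`lᵢ = 0` meeting the line `x = 0` in seven distinct points, then some nonzero `w`
with `x(w) = 0` is in the kernel of the polar form of `q` restricted to `ker x`.
(`V ≅ K³` after a choice of basis.) -/
theorem stmt_13 (K : Type*) [Field K] (p : ℕ) (hp : p.Prime) (hp5 : 5 ≤ p)
    (hchar : CharP K p)
    (x q : MvPolynomial (Fin 3) K) (l : Fin 7 → MvPolynomial (Fin 3) K)
    (hx : x.IsHomogeneous 1) (hx0 : x ≠ 0)
    (hq : q.IsHomogeneous 2) (hq0 : q ≠ 0)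
    (hl : ∀ i, (l i).IsHomogeneous 1)
    (heq : x ^ 2 * q = ∑ i, l i ^ 4)
    (hnp : ∀ (i : Fin 7) (c : K), l i ≠ C c * x)
    (hdist : ∀ i j : Fin 7, i ≠ j →
      {v : Fin 3 → K | eval v (l i) = 0 ∧ eval v x = 0} ≠
      {v : Fin 3 → K | eval v (l j) = 0 ∧ eval v x = 0}) :
    ∃ w : Fin 3 → K, w ≠ 0 ∧ eval w x = 0 ∧
      ∀ u : Fin 3 → K, eval u x = 0 →
        eval (w + u) q - eval w q - eval u q = 0 := by
  have hcast : ∀ n : ℕ, 0 < n → n < p → (n : K) ≠ 0 := fun n hn hnp h =>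
    Nat.not_le.2 hnp (Nat.le_of_dvd hn ((CharP.cast_eq_zero_iff K p n).1 h))
  have h2 : (2 : K) ≠ 0 := by exact_mod_cast hcast 2 (by omega) (by omega)
  have h3 : (3 : K) ≠ 0 := by exact_mod_cast hcast 3 (by omega) (by omega)
  obtain ⟨φ, hφ, hxφ⟩ := hx.exists_linearMap
  obtain ⟨Q, hQ⟩ := hq.exists_quadraticForm
  choose f hf hlf using fun i => (hl i).exists_linearMap
  have hφ0 : φ ≠ 0 := fun h0 => hx0 (by
    simpa using hxφ x φ 0 hx hφ (by simp [h0]))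
  have hspan : ∀ i (c : K), f i ≠ c • φ := fun i c h => hnp i c (hlf i x φ c hx hφ h)
  obtain ⟨e, he⟩ := LinearMap.surjective hφ0 1
  have hrank : Module.finrank K (LinearMap.ker φ) = 2 := by
    have := Module.Dual.finrank_ker_add_one_of_ne_zero hφ0
    rw [Module.finrank_fin_fun] at this
    omega
  let B := Module.finBasisOfFinrankEq K (LinearMap.ker φ) hrank
  have hB : ∀ i, φ (B i : Fin 3 → K) = 0 := fun i => LinearMap.mem_ker.1 (B i).2
  have hrep : ∀ v, φ v = 0 → ∃ y z : K, v = y • (B 0 : Fin 3 → K) + z • (B 1 : Fin 3 → K) := by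
    intro v hv
    have := congrArg Subtype.val (B.sum_repr ⟨v, LinearMap.mem_ker.2 hv⟩)
    rw [Fin.sum_univ_two] at this
    exact ⟨_, _, this.symm⟩
  have hnz : ∀ i, f i (B 0) ≠ 0 ∨ f i (B 1) ≠ 0 := by
    intro i
    by_contra! h0
    have hfi : ∀ v, φ v = 0 → f i v = 0 := by
      intro v hv
      obtain ⟨y, z, rfl⟩ := hrep v hv
      simp [h0.1, h0.2]
    refine hspan i (f i e) (LinearMap.ext fun v => ?_)
    have := hfi (v - φ v • e) (by simp [he])
    simp only [map_sub, map_smul, smul_eq_mul] at this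
    simp only [LinearMap.smul_apply, smul_eq_mul]
    linear_combination this
  have hsub : ∀ i j, f i (B 0) * f j (B 1) - f j (B 0) * f i (B 1) = 0 →
      ∀ v, φ v = 0 → f i v = 0 → f j v = 0 := by
    intro i j hij v hv hi
    obtain ⟨y, z, rfl⟩ := hrep v hv
    simp only [map_add, map_smul, smul_eq_mul] at hi ⊢
    rcases hnz i with h | h <;> refine (mul_eq_zero.1 ?_).resolve_left h
    · linear_combination f j (B 0) * hi + z * hij
    · linear_combination f j (B 1) * hi - y * hij
  obtain ⟨y, z, hyz, hw⟩ := exists_polar_eq_zero_of_basis h2 h3 (φ := φ) (Q := Q) (f := f)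
    (fun v => by simpa [hφ, hQ, hf] using congrArg (eval v) heq) he (hB 0) (hB 1)
    (fun i j hij h => hdist i j hij (by
      ext v
      simp only [Set.mem_ofPred_eq, hf, hφ]
      exact ⟨fun hv => ⟨hsub i j h v hv.2 hv.1, hv.2⟩,
        fun hv => ⟨hsub j i (by linear_combination -h) v hv.2 hv.1, hv.2⟩⟩))
  refine ⟨y • (B 0 : Fin 3 → K) + z • (B 1 : Fin 3 → K), fun h0 => ?_, by simp [hφ, hB], ?_⟩
  · have := Fintype.linearIndependent_iff.1 B.linearIndependent ![y, z] (by
      rw [Fin.sum_univ_two]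
      exact Subtype.ext h0)
    exact hyz.elim (· (this 0)) (· (this 1))
  · intro u hu
    obtain ⟨y', z', rfl⟩ := hrep u (by rw [← hφ, hu])
    simpa only [hQ] using hw y' z'
end

section
/- Let K be a field of characteristic 2 or 3 and V a K-vector space of dimension 3. Let x ∈ V* be a nonzero linear form and q a quadratic form on V. Suppose x²q = l₁⁴ + ⋯ + l₇⁴ for linear forms l₁,…,l₇ ∈ V* such that the seven lines lᵢ = 0 in P(V) intersect the line x = 0 in seven distinct points (no lᵢ is a scalar multiple of x, and for i ≠ j the subspaces ker lᵢ ∩ ker x and ker lⱼ ∩ ker x are distinct one-dimensional subspaces). Then x divides q in the symmetric algebra of V*; that is, q = x·m for some linear form m ∈ V*. -/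
open MvPolynomial

namespace MvPolynomial

variable {σ K : Type*}

lemma IsHomogeneous.exists_eq_mul_of_dvd [CommRing K] {x q : MvPolynomial σ K} {m n : ℕ}
    (hx : x.IsHomogeneous m) (hq : q.IsHomogeneous (m + n)) (h : x ∣ q) :
    ∃ r : MvPolynomial σ K, r.IsHomogeneous n ∧ q = x * r := by
  obtain ⟨r, rfl⟩ := h
  let := gradedAlgebra (σ := σ) (R := K)
  have key := DirectSum.coe_decompose_mul_add_of_left_mem (homogeneousSubmodule σ K)
    (i := m) (j := n) (b := r) ((mem_homogeneousSubmodule m x).2 hx)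
  rw [DirectSum.decompose_of_mem_same _ ((mem_homogeneousSubmodule _ _).2 hq)] at key
  exact ⟨_, (mem_homogeneousSubmodule _ _).1 (SetLike.coe_mem _), key⟩

lemma IsHomogeneous.exists_pderiv_eq_C [CommRing K] {f : MvPolynomial σ K}
    (hf : f.IsHomogeneous 1) (i : σ) : ∃ a : K, pderiv i f = C a :=
  ⟨_, totalDegree_eq_zero_iff_eq_C.1 (Nat.le_zero.1 (hf.pderiv (i := i)).totalDegree_le)⟩

lemma IsHomogeneous.exists_pderiv_ne_zero [CommRing K] [Fintype σ] {f : MvPolynomial σ K}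
    (hf : f.IsHomogeneous 1) (h0 : f ≠ 0) : ∃ i, pderiv i f ≠ 0 := by
  by_contra! h
  have := hf.sum_X_mul_pderiv
  simp [h] at this
  exact h0 this.symm

lemma IsHomogeneous.prime_of_one [Field K] {f : MvPolynomial σ K}
    (hf : f.IsHomogeneous 1) (h0 : f ≠ 0) : Prime f := by
  refine (irreducible_of_totalDegree_eq_one (hf.totalDegree h0) fun c hc ↦ ?_).prime
  obtain ⟨d, hd⟩ := ne_zero_iff.1 h0
  exact (ne_zero_of_dvd_ne_zero hd (hc d)).isUnit

lemma dvd_of_sq_mul_eq_sum_pow_four_of_char_two [Field K] [CharP K 2] {ι : Type*} (s : Finset ι)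
    {x q : MvPolynomial σ K} (l : ι → MvPolynomial σ K)
    (hx : x.IsHomogeneous 1) (hx0 : x ≠ 0) (heq : x ^ 2 * q = ∑ i ∈ s, l i ^ 4) : x ∣ q := by
  have hsum : ∑ i ∈ s, l i ^ 4 = (∑ i ∈ s, l i) ^ 4 := (sum_pow_char_pow 2 2 s l).symm
  rw [hsum] at heq
  obtain ⟨m, hm⟩ := (hx.prime_of_one hx0).dvd_of_dvd_pow
    (heq ▸ dvd_mul_of_dvd_left (dvd_pow_self x two_ne_zero) q)
  refine ⟨x * m ^ 4, mul_left_cancel₀ (pow_ne_zero 2 hx0) ?_⟩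
  rw [heq, hm]
  ring

lemma dvd_of_sq_mul_eq_sum_pow_four_of_char_three [Field K] [CharP K 3] [Fintype σ] {ι : Type*}
    (s : Finset ι) {x q : MvPolynomial σ K} {l : ι → MvPolynomial σ K}
    (hx : x.IsHomogeneous 1) (hx0 : x ≠ 0) (hl : ∀ i, (l i).IsHomogeneous 1)
    (heq : x ^ 2 * q = ∑ i ∈ s, l i ^ 4) : x ∣ q := by
  have h3 : (3 : MvPolynomial σ K) = 0 := CharP.cast_eq_zero (MvPolynomial σ K) 3
  obtain ⟨j, hj⟩ := hx.exists_pderiv_ne_zero hx0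
  obtain ⟨c, hc⟩ := hx.exists_pderiv_eq_C j
  choose a ha using fun i ↦ (hl i).exists_pderiv_eq_C j
  have hc0 : c ≠ 0 := by
    rintro rfl
    exact hj (by rw [hc, C_0])
  have hsum : pderiv j (pderiv j (∑ i ∈ s, l i ^ 4)) = 0 := by
    simp only [map_sum]
    refine Finset.sum_eq_zero fun i _ ↦ ?_
    simp only [pderiv_pow, pderiv_mul, ha, pderiv_C, Derivation.map_natCast]
    push_cast
    linear_combination (4 * l i ^ 2 * C (a i) * C (a i)) * h3
  rw [← heq] at hsum
  simp only [pderiv_pow, pderiv_mul, hc, pderiv_C, map_add, Derivation.map_natCast] at hsum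
  push_cast at hsum
  have hunit : IsUnit (C c ^ 2 : MvPolynomial σ K) := (hc0.isUnit.map C).pow 2
  refine (hunit.dvd_mul_left).1
    ⟨4 * C c * pderiv j q + x * pderiv j (pderiv j q), ?_⟩
  linear_combination C c ^ 2 * q * h3 - hsum

end MvPolynomial

/-- over a field of characteristic 2 or 3, if `x² q = l₁⁴ + ⋯ + l₇⁴`
with the seven lines `lᵢ = 0` meeting the line `x = 0` in seven distinct points, then
`x` divides `q`: `q = x·m` for some linear form `m`. (`V ≅ K³` after a choice of
basis.) -/
theorem stmt_14 (K : Type*) [Field K] (hchar : CharP K 2 ∨ CharP K 3)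
    (x q : MvPolynomial (Fin 3) K) (l : Fin 7 → MvPolynomial (Fin 3) K)
    (hx : x.IsHomogeneous 1) (hx0 : x ≠ 0)
    (hq : q.IsHomogeneous 2)
    (hl : ∀ i, (l i).IsHomogeneous 1)
    (heq : x ^ 2 * q = ∑ i, l i ^ 4)
    (hnp : ∀ (i : Fin 7) (c : K), l i ≠ C c * x)
    (hdist : ∀ i j : Fin 7, i ≠ j →
      {v : Fin 3 → K | eval v (l i) = 0 ∧ eval v x = 0} ≠
      {v : Fin 3 → K | eval v (l j) = 0 ∧ eval v x = 0}) :
    ∃ m : MvPolynomial (Fin 3) K, m.IsHomogeneous 1 ∧ q = x * m := by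
  refine hx.exists_eq_mul_of_dvd hq ?_
  rcases hchar with _ | _
  · exact dvd_of_sq_mul_eq_sum_pow_four_of_char_two _ l hx hx0 heq
  · exact dvd_of_sq_mul_eq_sum_pow_four_of_char_three _ hx hx0 hl heq
end
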